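/- arXiv:0910.2608 — 5 statements merged into one kernel-verified Lean document; each statement's English description precedes it below -/
import Mathlib

section
/- For every integer N ≥ 1, the number of 3-noncrossing set partitions of [N] = {1,…,N} equals ω^{1,0}_{2N}, the number of P_{W2}-walks of length 2N ending at (1,0). -/
/-- The quarter plane `Q₂ = {(a,b) : a ≥ 0, b ≥ 0}`. -/
def Q2 : Set (ℤ × ℤ) := {p | 0 ≤ p.1 ∧ 0 ≤ p.2}

/-- The Weyl chamber `W₂ = {(a,b) : a > b ≥ 0}`. -/
def W2 : Set (ℤ × ℤ) := {p | p.2 < p.1 ∧ 0 ≤ p.2}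

/-- A "down" step: `(-1,0)`, `(0,-1)` or `(0,0)`. -/
def DownStep (d : ℤ × ℤ) : Prop := d = (-1, 0) ∨ d = (0, -1) ∨ d = (0, 0)

/-- An "up" step: `(1,0)`, `(0,1)` or `(0,0)`. -/
def UpStep (d : ℤ × ℤ) : Prop := d = (1, 0) ∨ d = (0, 1) ∨ d = (0, 0)

/-- A `𝒫_D`-walk of length `s`: starts at `(1,0)`, stays in `D`, odd steps are
down steps, even steps are up steps.  (The walk is encoded as a function
`ℕ → ℤ × ℤ` which is constant from index `s` on.) -/
def IsPWalk (D : Set (ℤ × ℤ)) (s : ℕ) (w : ℕ → ℤ × ℤ) : Prop :=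
  w 0 = (1, 0) ∧ (∀ r ≤ s, w r ∈ D) ∧
  (∀ r, 1 ≤ r → r ≤ s → r % 2 = 1 → DownStep (w r - w (r - 1))) ∧
  (∀ r, 1 ≤ r → r ≤ s → r % 2 = 0 → UpStep (w r - w (r - 1))) ∧
  (∀ r, s ≤ r → w r = w s)

/-- A `ℬ_D`-walk of length `s`: starts at `(1,0)`, stays in `D`, odd steps are
up steps, even steps are down steps. -/
def IsBWalk (D : Set (ℤ × ℤ)) (s : ℕ) (w : ℕ → ℤ × ℤ) : Prop :=
  w 0 = (1, 0) ∧ (∀ r ≤ s, w r ∈ D) ∧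
  (∀ r, 1 ≤ r → r ≤ s → r % 2 = 1 → UpStep (w r - w (r - 1))) ∧
  (∀ r, 1 ≤ r → r ≤ s → r % 2 = 0 → DownStep (w r - w (r - 1))) ∧
  (∀ r, s ≤ r → w r = w s)

/-- `a^{i,j}_s`: the number of `𝒫_{Q₂}`-walks of length `s` ending at `p`. -/
noncomputable def aQ (s : ℕ) (p : ℤ × ℤ) : ℕ :=
  Nat.card {w : ℕ → ℤ × ℤ // IsPWalk Q2 s w ∧ w s = p}

/-- `ω^{i,j}_s`: the number of `𝒫_{W₂}`-walks of length `s` ending at `p`. -/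
noncomputable def omegaW (s : ℕ) (p : ℤ × ℤ) : ℕ :=
  Nat.card {w : ℕ → ℤ × ℤ // IsPWalk W2 s w ∧ w s = p}

/-- `σ^{i,j}_s`: the number of `ℬ_{W₂}`-walks of length `s` ending at `p`. -/
noncomputable def sigmaB (s : ℕ) (p : ℤ × ℤ) : ℕ :=
  Nat.card {w : ℕ → ℤ × ℤ // IsBWalk W2 s w ∧ w s = p}

/-- No index `q ≥ 1` with steps `w_{2q-1} - w_{2q-2} = (1,0)` and
`w_{2q} - w_{2q-1} = (-1,0)`. -/
def NoUpDownPair (s : ℕ) (w : ℕ → ℤ × ℤ) : Prop :=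
  ∀ q, 1 ≤ q → 2 * q ≤ s →
    ¬ (w (2 * q - 1) - w (2 * q - 2) = (1, 0) ∧ w (2 * q) - w (2 * q - 1) = (-1, 0))

/-- A `ℬ*_{W₂}`-walk. -/
def IsBStarWalk (s : ℕ) (w : ℕ → ℤ × ℤ) : Prop :=
  IsBWalk W2 s w ∧ NoUpDownPair s w

/-- `σ*^{i,j}_s`: the number of `ℬ*_{W₂}`-walks of length `s` ending at `p`. -/
noncomputable def sigmaStar (s : ℕ) (p : ℤ × ℤ) : ℕ :=
  Nat.card {w : ℕ → ℤ × ℤ // IsBStarWalk s w ∧ w s = p}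
/-- `i` and `j` lie in a common block of the partition `P`. -/
def SameBlock {N : ℕ} (P : Finpartition (Finset.univ : Finset (Fin N))) (i j : Fin N) : Prop :=
  ∃ B ∈ P.parts, i ∈ B ∧ j ∈ B

/-- `(i,j)` is an arc of the standard representation of the partition `P`:
`i < j` lie in a common block with no element of that block strictly between them. -/
def IsArc {N : ℕ} (P : Finpartition (Finset.univ : Finset (Fin N))) (i j : Fin N) : Prop :=
  i < j ∧ SameBlock P i j ∧ ∀ l : Fin N, i < l → l < j → ¬ SameBlock P i l

/-- The partition `P` has a `k`-crossing: arcs `(i₁,j₁),…,(i_k,j_k)` with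
`i₁ < … < i_k < j₁ < … < j_k`. -/
def PartitionHasKCrossing {N : ℕ} (k : ℕ)
    (P : Finpartition (Finset.univ : Finset (Fin N))) : Prop :=
  ∃ a b : Fin k → Fin N, StrictMono a ∧ StrictMono b ∧
    (∀ m, IsArc P (a m) (b m)) ∧ ∀ m m', a m < b m'

/-- A `k`-noncrossing set partition. -/
def IsKNoncrossingPartition {N : ℕ} (k : ℕ)
    (P : Finpartition (Finset.univ : Finset (Fin N))) : Prop :=
  ¬ PartitionHasKCrossing k P

/-- A `2`-regular partition: distinct elements of a common block differ by at least `2`. -/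
def IsTwoRegular {N : ℕ} (P : Finpartition (Finset.univ : Finset (Fin N))) : Prop :=
  ∀ i j : Fin N, SameBlock P i j → i ≠ j → 2 ≤ |(i : ℤ) - (j : ℤ)|

/-- A braid over `[M]`, given as its finite set of arcs `(i,j)` with `i ≤ j`:
every vertex is the smaller endpoint of at most one arc and the larger endpoint
of at most one arc. -/
def IsBraid {M : ℕ} (B : Finset (Fin M × Fin M)) : Prop :=
  (∀ p ∈ B, p.1 ≤ p.2) ∧
  (∀ p ∈ B, ∀ q ∈ B, p.1 = q.1 → p = q) ∧
  (∀ p ∈ B, ∀ q ∈ B, p.2 = q.2 → p = q)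

/-- The braid `B` has a `k`-crossing: arcs `(i₁,j₁),…,(i_k,j_k)` with
`i₁ < … < i_k ≤ j₁ < … < j_k`. -/
def BraidHasKCrossing {M : ℕ} (k : ℕ) (B : Finset (Fin M × Fin M)) : Prop :=
  ∃ a b : Fin k → Fin M, StrictMono a ∧ StrictMono b ∧
    (∀ m, (a m, b m) ∈ B) ∧ ∀ m m', a m ≤ b m'

/-- A `k`-noncrossing braid. -/
def IsKNoncrossingBraid {M : ℕ} (k : ℕ) (B : Finset (Fin M × Fin M)) : Prop :=
  IsBraid B ∧ ¬ BraidHasKCrossing k B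

/-- The braid `B` contains a loop `(i,i)`. -/
def HasLoop {M : ℕ} (B : Finset (Fin M × Fin M)) : Prop := ∃ i, (i, i) ∈ B

/-- The steps allowed at time `r` in a `𝒫`-walk. -/
def walkSteps (r : ℕ) : Finset (ℤ × ℤ) :=
  if r % 2 = 1 then {(-1, 0), (0, -1), (0, 0)} else {(1, 0), (0, 1), (0, 0)}

theorem isPWalk_iff_walkSteps (D : Set (ℤ × ℤ)) (s : ℕ) (w : ℕ → ℤ × ℤ) :
    IsPWalk D s w ↔ w 0 = (1, 0) ∧ (∀ r ≤ s, w r ∈ D) ∧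
      (∀ r < s, w (r + 1) - w r ∈ walkSteps (r + 1)) ∧ (∀ r, s ≤ r → w r = w s) := by
  constructor
  · rintro ⟨h0, hD, hd, hu, hc⟩
    refine ⟨h0, hD, fun r hr => ?_, hc⟩
    have h1 := hd (r + 1) (by omega) (by omega)
    have h2 := hu (r + 1) (by omega) (by omega)
    rcases Nat.mod_two_eq_zero_or_one (r + 1) with h | h
    · simpa [walkSteps, h, UpStep] using h2 h
    · simpa [walkSteps, h, DownStep] using h1 h
  · rintro ⟨h0, hD, hs, hc⟩
    refine ⟨h0, hD, fun r h1 hr h => ?_, fun r h1 hr h => ?_, hc⟩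
    all_goals
      obtain ⟨r, rfl⟩ : ∃ t, r = t + 1 := ⟨r - 1, by omega⟩
      simpa [walkSteps, h, UpStep, DownStep] using hs r (by omega)

/-- `𝒫_{W₂}`-walks of length `s` ending at `p`. -/
abbrev WalksTo (s : ℕ) (p : ℤ × ℤ) : Type :=
  {w : ℕ → ℤ × ℤ // IsPWalk W2 s w ∧ w s = p}

theorem sigma_walksTo_ext {s : ℕ} {p : ℤ × ℤ} {D : Finset (ℤ × ℤ)}
    {x y : Σ d : D, WalksTo s (p - d.1)} (h : x.1 = y.1) (h' : x.2.1 = y.2.1) : x = y := by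
  obtain ⟨d, w⟩ := x
  obtain ⟨e, v⟩ := y
  obtain rfl : d = e := h
  obtain rfl : w = v := Subtype.ext h'
  rfl

/-- Splitting off the last step of a walk. -/
def walksToSuccEquiv (s : ℕ) (p : ℤ × ℤ) (hp : p ∈ W2) :
    WalksTo (s + 1) p ≃ Σ d : walkSteps (s + 1), WalksTo s (p - d.1) where
  toFun w := ⟨⟨p - w.1 s, by
      have := ((isPWalk_iff_walkSteps _ _ _).1 w.2.1).2.2.1 s (by omega)
      rwa [w.2.2] at this⟩,
    ⟨fun r => w.1 (min r s), by
      obtain ⟨w, hw, he⟩ := w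
      obtain ⟨h0, hD, hs, hc⟩ := (isPWalk_iff_walkSteps _ _ _).1 hw
      refine ⟨(isPWalk_iff_walkSteps _ _ _).2 ⟨by simpa using h0, fun r hr => hD _ (by omega),
        fun r hr => ?_, fun r hr => ?_⟩, by simp⟩
      · have h1 : min (r + 1) s = r + 1 := by omega
        have h2 : min r s = r := by omega
        simpa only [h1, h2] using hs r (by omega)
      · simp [hr]⟩⟩
  invFun x := ⟨fun r => if r ≤ s then x.2.1 r else p, by
    obtain ⟨⟨d, hd⟩, ⟨w, hw, he⟩⟩ := x
    obtain ⟨h0, hD, hs, hc⟩ := (isPWalk_iff_walkSteps _ _ _).1 hw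
    refine ⟨(isPWalk_iff_walkSteps _ _ _).2 ⟨by simpa using h0, fun r hr => ?_,
        fun r hr => ?_, fun r hr => ?_⟩, by simp⟩
    · dsimp only
      split_ifs with h
      · exact hD r h
      · exact hp
    · dsimp only
      rcases Nat.lt_succ_iff_lt_or_eq.1 hr with h | rfl
      · rw [if_pos (by omega), if_pos (by omega)]
        exact hs r h
      · rw [if_neg (by omega), if_pos le_rfl, he]
        simpa using hd
    · dsimp only
      rw [if_neg (by omega), if_neg (by omega)]⟩
  left_inv w := by
    obtain ⟨w, hw, he⟩ := w
    obtain ⟨h0, hD, hs, hc⟩ := (isPWalk_iff_walkSteps _ _ _).1 hw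
    refine Subtype.ext (funext fun r => ?_)
    dsimp only
    split_ifs with h
    · rw [min_eq_left h]
    · rw [hc r (by omega), he]
  right_inv x := by
    obtain ⟨⟨d, hd⟩, ⟨w, hw, he⟩⟩ := x
    obtain ⟨h0, hD, hs, hc⟩ := (isPWalk_iff_walkSteps _ _ _).1 hw
    dsimp only at he
    have h1 : p - w s = d := by rw [he]; simp
    refine sigma_walksTo_ext (Subtype.ext (by simpa using h1)) (funext fun r => ?_)
    dsimp only
    rw [if_pos (min_le_right _ _)]
    rcases le_total r s with h | h
    · rw [min_eq_left h]
    · rw [min_eq_right h, hc r h]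

theorem isEmpty_walksTo (s : ℕ) {p : ℤ × ℤ} (hp : p ∉ W2) : IsEmpty (WalksTo s p) :=
  ⟨fun w => hp (w.2.2 ▸ w.2.1.2.1 s le_rfl)⟩

theorem walksTo_zero_eq {p : ℤ × ℤ} (w : WalksTo 0 p) :
    w.1 = fun _ => (1, 0) := by
  funext r
  rw [w.2.1.2.2.2.2 r (Nat.zero_le _), w.2.1.1]

instance finite_walksTo (s : ℕ) (p : ℤ × ℤ) : Finite (WalksTo s p) := by
  induction s generalizing p with
  | zero =>
    have : Subsingleton (WalksTo 0 p) :=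
      ⟨fun a b => Subtype.ext (by rw [walksTo_zero_eq a, walksTo_zero_eq b])⟩
    infer_instance
  | succ s ih =>
    by_cases hp : p ∈ W2
    · exact Finite.of_equiv _ (walksToSuccEquiv s p hp).symm
    · have := isEmpty_walksTo (s + 1) hp
      infer_instance

theorem omegaW_of_notMem (s : ℕ) {p : ℤ × ℤ} (hp : p ∉ W2) : omegaW s p = 0 := by
  have := isEmpty_walksTo s hp
  exact Nat.card_of_isEmpty

theorem omegaW_succ (s : ℕ) {p : ℤ × ℤ} (hp : p ∈ W2) :
    omegaW (s + 1) p = ∑ d ∈ walkSteps (s + 1), omegaW s (p - d) := by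
  unfold omegaW
  rw [Nat.card_congr (walksToSuccEquiv s p hp), Nat.card_sigma]
  exact Finset.sum_coe_sort (walkSteps (s + 1)) (fun d => Nat.card (WalksTo s (p - d)))

theorem omegaW_zero (p : ℤ × ℤ) : omegaW 0 p = if p = (1, 0) then 1 else 0 := by
  split_ifs with h
  · subst h
    refine Nat.card_eq_one_iff_unique.2
      ⟨⟨fun a b => Subtype.ext (by rw [walksTo_zero_eq a, walksTo_zero_eq b])⟩,
        ⟨fun _ => (1, 0), (isPWalk_iff_walkSteps _ _ _).2 ⟨rfl, ?_, ?_, ?_⟩, rfl⟩⟩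
    · intro r hr
      simp [W2]
    · intro r hr
      omega
    · intro r hr
      rfl
  · have : IsEmpty (WalksTo 0 p) := ⟨fun w => h (w.2.2 ▸ w.2.1.1)⟩
    exact Nat.card_of_isEmpty

/-- Predecessor functions on `[0, n)` (with `f j = j` when `j` closes no arc) whose arcs
`(f j, j)`, together with the open arcs starting in `A ∪ B`, form no 3-crossing; open arcs
starting at `c < d` are closed in the order `c`, `d` when `c ∈ A` and `d ∈ B`. -/
def PredFun (n : ℕ) (A B : Finset ℕ) : Set (ℕ → ℕ) :=
  {f | (∀ j, f j ≤ j) ∧ (∀ j, n ≤ j → f j = j) ∧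
    (∀ i j, f i < i → f j < j → f i = f j → i = j) ∧
    (∀ j, f j < j → f j ∉ A ∧ f j ∉ B) ∧
    (∀ i j k, i < j → j < k → f i < f j → f j < f k → i ≤ f k) ∧
    (∀ i j s, i < j → s ∈ A ∨ s ∈ B → f i < f j → f j < s → i ≤ s) ∧
    (∀ i c d, c ∈ A → d ∈ B → f i < c → c < d → i ≤ d)}

/-- `x` may be inserted in the first row `A` of a tableau with rows `A` and `B` without
creating a third row. -/
def Insertable (x : ℕ) (A B : Finset ℕ) : Prop :=
  x ∉ A ∧ x ∉ B ∧ ∀ c ∈ A, ∀ d ∈ B, x < c → d ≤ c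

open Classical in
/-- Row insertion of `x` in the two-row tableau `T`. -/
noncomputable def rowInsert (x : ℕ) (T : Finset ℕ × Finset ℕ) : Finset ℕ × Finset ℕ :=
  if h : ∃ y, y ∈ T.1 ∧ x < y then
    ((insert x T.1).erase (Nat.find h), insert (Nat.find h) T.2)
  else (insert x T.1, T.2)

theorem rowInsert_cases (x : ℕ) (A B : Finset ℕ) :
    ((∀ c ∈ A, c ≤ x) ∧ rowInsert x (A, B) = (insert x A, B)) ∨
    ∃ y ∈ A, x < y ∧ (∀ c ∈ A, x < c → y ≤ c) ∧
      rowInsert x (A, B) = ((insert x A).erase y, insert y B) := by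
  classical
  by_cases h : ∃ y, y ∈ A ∧ x < y
  · right
    refine ⟨Nat.find h, (Nat.find_spec h).1, (Nat.find_spec h).2,
      fun c hc hx => Nat.find_min' h ⟨hc, hx⟩, ?_⟩
    rw [rowInsert, dif_pos h]
  · left
    refine ⟨fun c hc => not_lt.1 fun hx => h ⟨c, hc, hx⟩, ?_⟩
    rw [rowInsert, dif_neg h]

theorem rowInsert_mem_or (x : ℕ) (A B : Finset ℕ) (s : ℕ) :
    s ∈ (rowInsert x (A, B)).1 ∨ s ∈ (rowInsert x (A, B)).2 ↔ s = x ∨ s ∈ A ∨ s ∈ B := by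
  rcases rowInsert_cases x A B with ⟨h, e⟩ | ⟨y, hy, hxy, hm, e⟩
  · rw [e]; simp [or_assoc]
  · rw [e]
    simp only [Finset.mem_erase, Finset.mem_insert]
    by_cases hs : s = y
    · simp [hs, hy]
    · tauto

/-- The tableau records which pairs of open arcs are closed in order. -/
theorem exists_rowInsert_iff {x : ℕ} {A B : Finset ℕ} (hx : Insertable x A B) (z k : ℕ) :
    (∃ c d, c ∈ (rowInsert x (A, B)).1 ∧ d ∈ (rowInsert x (A, B)).2 ∧ z < c ∧ c < d ∧ d < k) ↔
    (∃ c d, c ∈ A ∧ d ∈ B ∧ z < c ∧ c < d ∧ d < k) ∨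
      (z < x ∧ ∃ d, (d ∈ A ∨ d ∈ B) ∧ x < d ∧ d < k) := by
  obtain ⟨hA, hB, hok⟩ := hx
  rcases rowInsert_cases x A B with ⟨h, e⟩ | ⟨y, hy, hxy, hm, e⟩
  · rw [e]
    constructor
    · grind
    · rintro (⟨c, d, hc, hd, h1, h2, h3⟩ | ⟨h1, d, hd, h2, h3⟩) <;> grind
  · rw [e]
    constructor
    · rintro ⟨c, d, hc, hd, h1, h2, h3⟩
      have := hm c
      grind
    · rintro (⟨c, d, hc, hd, h1, h2, h3⟩ | ⟨h1, d, hd, h2, h3⟩)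
      · refine ⟨c, d, ?_, ?_, h1, h2, h3⟩
        · have := hok c hc d hd
          grind
        · grind
      · rcases hd with hd | hd
        · have := hm d hd h2
          exact ⟨x, y, by grind, by grind, h1, hxy, by omega⟩
        · exact ⟨x, d, by grind, by grind, h1, h2, h3⟩

theorem predFun_congr_erase (n : ℕ) (A B : Finset ℕ) :
    PredFun (n + 1) (A.erase n) (B.erase n) = PredFun (n + 1) A B := by
  ext f
  simp only [PredFun, Set.mem_ofPred_eq, Finset.mem_erase]
  refine and_congr_right fun h1 => and_congr_right fun h2 => and_congr_right fun h3 => ?_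
  have key : ∀ i, f i < i → i < n + 1 := fun i hi => by
    by_contra h
    have := h2 i (by omega)
    omega
  constructor
  · rintro ⟨h4, h5, h6, h7⟩
    refine ⟨fun j hj => ?_, h5, fun i j s hij hs a b => ?_, fun i c d hc hd a b => ?_⟩
    · have := h4 j hj
      have := key j hj
      have : f j ≠ n := by omega
      tauto
    · by_contra hlt
      have := key i (by omega)
      have : s ≠ n := by omega
      exact hlt (h6 i j s hij (by tauto) a b)
    · by_contra hlt
      have := key i (by omega)
      exact hlt (h7 i c d ⟨by omega, hc⟩ ⟨by omega, hd⟩ a b)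
  · rintro ⟨h4, h5, h6, h7⟩
    refine ⟨fun j hj => ?_, h5, fun i j s hij hs a b => ?_, fun i c d hc hd a b => ?_⟩
    · have := h4 j hj
      tauto
    · exact h6 i j s hij (by tauto) a b
    · exact h7 i c d hc.2 hd.2 a b

theorem mem_predFun_succ_of_eq {n : ℕ} {A B : Finset ℕ} {f : ℕ → ℕ} (hf : f n = n) :
    f ∈ PredFun (n + 1) A B ↔ f ∈ PredFun n A B := by
  simp only [PredFun, Set.mem_ofPred_eq]
  refine and_congr_right fun h1 => and_congr_left fun _ => ?_
  constructor
  · intro h j hj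
    rcases hj.eq_or_lt with rfl | hj
    · exact hf
    · exact h j hj
  · exact fun h j hj => h j (by omega)

theorem update_mem_predFun_succ {n x : ℕ} {A B : Finset ℕ} {g : ℕ → ℕ} (hg : g n = n)
    (hxn : x < n) (hA : ∀ a ∈ A, a < n) (hB : ∀ a ∈ B, a < n) :
    Function.update g n x ∈ PredFun (n + 1) A B ↔
      Insertable x A B ∧ g ∈ PredFun n (rowInsert x (A, B)).1 (rowInsert x (A, B)).2 := by
  set f := Function.update g n x with hfdef
  have fn : f n = x := by simp [hfdef]
  have fne : ∀ j, j ≠ n → f j = g j := fun j hj => by simp [hfdef, hj]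
  constructor
  · rintro ⟨h1, h2, h3, h4, h5, h6, h7⟩
    have hx : Insertable x A B := by
      have h4n := h4 n (by omega)
      rw [fn] at h4n
      refine ⟨h4n.1, h4n.2, fun c hc d hd hxc => ?_⟩
      by_contra hcd
      have := h7 n c d hc hd (by omega) (by omega)
      have := hB d hd
      omega
    have g1 : ∀ j, g j ≤ j := fun j => by
      by_cases hj : j = n
      · subst hj; omega
      · rw [← fne j hj]; exact h1 j
    have g2 : ∀ j, n ≤ j → g j = j := fun j hj => by
      by_cases hj' : j = n
      · subst hj'; omega
      · rw [← fne j hj']; exact h2 j (by omega)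
    have key : ∀ i, g i < i → i < n := fun i hi => by
      by_contra h
      have := g2 i (by omega)
      omega
    refine ⟨hx, g1, g2, fun i j hi hj hij => ?_, fun j hj => ?_,
      fun i j k hij hjk a b => ?_, fun i j s hij hs a b => ?_, fun i c d hc hd a b => ?_⟩
    · have hi' := fne i (key i hi).ne
      have hj' := fne j (key j hj).ne
      exact h3 i j (by omega) (by omega) (by omega)
    · have hj' := fne j (key j hj).ne
      have e4 := h4 j (by omega)
      rw [hj'] at e4
      have : g j ≠ x := fun h => by
        have := h3 j n (by omega) (by omega) (by omega)
        have := key j hj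
        omega
      have := rowInsert_mem_or x A B (g j)
      tauto
    · by_contra hlt
      have := g1 i; have := g1 j; have := g1 k
      have hi := fne i (key i (by omega)).ne
      have hj := fne j (key j (by omega)).ne
      have hk := fne k (key k (by omega)).ne
      have := h5 i j k hij hjk (by omega) (by omega)
      omega
    · by_contra hlt
      have := g1 i; have := g1 j
      have hi := fne i (key i (by omega)).ne
      have hjn := key j (by omega)
      have hj := fne j hjn.ne
      rcases (rowInsert_mem_or x A B s).1 hs with rfl | hs
      · have := h5 i j n hij hjn (by omega) (by omega)
        omega
      · have := h6 i j s hij hs (by omega) (by omega)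
        omega
    · by_contra hlt
      have hin := key i (by omega)
      have hi := fne i hin.ne
      rcases (exists_rowInsert_iff hx (g i) i).1 ⟨c, d, hc, hd, a, b, by omega⟩ with
        ⟨c, d, hc, hd, p1, p2, p3⟩ | ⟨p1, d, hd, p2, p3⟩
      · have := h7 i c d hc hd (by omega) p2
        omega
      · have := h6 i n d hin hd (by omega) (by omega)
        omega
  · rintro ⟨hx, h1, h2, h3, h4, h5, h6, h7⟩
    have f1 : ∀ j, f j ≤ j := fun j => by
      by_cases hj : j = n
      · subst hj; omega
      · rw [fne j hj]; exact h1 j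
    have f2 : ∀ j, n + 1 ≤ j → f j = j := fun j hj => by
      rw [fne j (by omega)]; exact h2 j (by omega)
    have key : ∀ i, f i < i → i ≤ n := fun i hi => by
      by_contra h
      have := f2 i (by omega)
      omega
    have gx : ∀ j, g j < j → g j ≠ x ∧ g j ∉ A ∧ g j ∉ B := fun j hj => by
      have := rowInsert_mem_or x A B (g j)
      have := h4 j hj
      tauto
    refine ⟨f1, f2, fun i j hi hj hij => ?_, fun j hj => ?_,
      fun i j k hij hjk a b => ?_, fun i j s hij hs a b => ?_, fun i c d hc hd a b => ?_⟩
    · by_cases hin : i = n <;> by_cases hjn : j = n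
      · omega
      · have := fne j hjn
        subst hin
        exact absurd (by omega) (gx j (by omega)).1
      · have := fne i hin
        subst hjn
        exact absurd (by omega) (gx i (by omega)).1
      · have := fne j hjn
        have := fne i hin
        exact h3 i j (by omega) (by omega) (by omega)
    · by_cases hjn : j = n
      · subst hjn
        rw [fn]
        exact ⟨hx.1, hx.2.1⟩
      · rw [fne j hjn] at hj ⊢
        exact (gx j hj).2
    · by_contra hlt
      have := f1 i; have := f1 j; have := f1 k
      have := key k (by omega)
      have hi := fne i (by omega)
      have hj := fne j (by omega)
      by_cases hk : k = n
      · subst hk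
        have := h6 i j x hij ((rowInsert_mem_or x A B x).2 (Or.inl rfl)) (by omega) (by omega)
        omega
      · have := fne k hk
        have := h5 i j k hij hjk (by omega) (by omega)
        omega
    · by_contra hlt
      have := f1 i; have := f1 j
      have := key j (by omega)
      have hi := fne i (by omega)
      by_cases hj : j = n
      · subst hj
        obtain ⟨c, d, hc, hd, p1, p2, p3⟩ := (exists_rowInsert_iff hx (g i) i).2
          (Or.inr ⟨by omega, s, hs, by omega, by omega⟩)
        have := h7 i c d hc hd p1 p2
        omega
      · have := fne j hj
        have := h6 i j s hij ((rowInsert_mem_or x A B s).2 (Or.inr hs)) (by omega) (by omega)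
        omega
    · by_contra hlt
      have := key i (by omega)
      by_cases hi : i = n
      · subst hi
        have := hx.2.2 c hc d hd (by omega)
        omega
      · have := fne i hi
        obtain ⟨c, d, hc, hd, p1, p2, p3⟩ := (exists_rowInsert_iff hx (g i) i).2
          (Or.inl ⟨c, d, hc, hd, by omega, b, by omega⟩)
        have := h7 i c d hc hd p1 p2
        omega

theorem finite_predFun (n : ℕ) (A B : Finset ℕ) : (PredFun n A B).Finite := by
  have hinj : Function.Injective (fun (f : PredFun n A B) (i : Fin n) =>
      (⟨f.1 i, (f.2.1 i).trans_lt i.2⟩ : Fin n)) := by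
    intro f g h
    refine Subtype.ext (funext fun j => ?_)
    rcases lt_or_ge j n with hj | hj
    · simpa using congr_fun h ⟨j, hj⟩
    · rw [f.2.2.1 j hj, g.2.2.1 j hj]
  have := Finite.of_injective _ hinj
  exact Set.toFinite _

/-- The number of predecessor functions on `[0, n)` compatible with the tableau `T`. -/
noncomputable def predCount (n : ℕ) (T : Finset ℕ × Finset ℕ) : ℕ :=
  (PredFun n T.1 T.2).ncard

open Classical in
theorem predCount_succ {n : ℕ} {T : Finset ℕ × Finset ℕ} (hA : ∀ a ∈ T.1, a < n + 1)
    (hB : ∀ a ∈ T.2, a < n + 1) :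
    predCount (n + 1) T = predCount n (T.1.erase n, T.2.erase n) +
      ∑ x ∈ (Finset.range n).filter (fun x => Insertable x (T.1.erase n) (T.2.erase n)),
        predCount n (rowInsert x (T.1.erase n, T.2.erase n)) := by
  obtain ⟨A, B⟩ := T
  dsimp only [predCount] at *
  rw [← predFun_congr_erase]
  have hA' : ∀ a ∈ A.erase n, a < n := fun a ha => by
    have := hA a (Finset.mem_of_mem_erase ha)
    have := Finset.ne_of_mem_erase ha
    omega
  have hB' : ∀ a ∈ B.erase n, a < n := fun a ha => by
    have := hB a (Finset.mem_of_mem_erase ha)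
    have := Finset.ne_of_mem_erase ha
    omega
  generalize A.erase n = A' at *
  generalize B.erase n = B' at *
  have hfin := finite_predFun (n + 1) A' B'
  rw [Set.ncard_eq_toFinset_card _ hfin,
    Finset.card_eq_sum_card_fiberwise (f := fun f : ℕ → ℕ => f n) (t := Finset.range (n + 1)),
    Finset.sum_range_succ, add_comm, Finset.sum_filter]
  · congr 1
    · rw [Set.ncard_eq_toFinset_card _ (finite_predFun n A' B')]
      congr 1
      ext f
      simp only [Finset.mem_filter, Set.Finite.mem_toFinset]
      constructor
      · rintro ⟨h, hn⟩
        exact (mem_predFun_succ_of_eq hn).1 h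
      · intro h
        have hn := h.2.1 n le_rfl
        exact ⟨(mem_predFun_succ_of_eq hn).2 h, hn⟩
    · refine Finset.sum_congr rfl fun x hx => ?_
      have hxn := Finset.mem_range.1 hx
      have key : ∀ f ∈ PredFun (n + 1) A' B', f n = x → Insertable x A' B' ∧
          Function.update f n n ∈ PredFun n (rowInsert x (A', B')).1 (rowInsert x (A', B')).2 := by
        rintro f h rfl
        have e : Function.update (Function.update f n n) n (f n) = f := by simp
        rw [← e] at h
        exact (update_mem_predFun_succ (by simp) hxn hA' hB').1 h
      split_ifs with hi
      · rw [Set.ncard_eq_toFinset_card _ (finite_predFun n _ _)]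
        refine Finset.card_nbij' (fun f => Function.update f n n)
          (fun g => Function.update g n x) ?_ ?_ ?_ ?_
        · intro f hf
          simp only [Finset.coe_filter, Set.Finite.mem_toFinset, Set.mem_ofPred_eq] at hf
          simpa using (key f hf.1 hf.2).2
        · intro g hg
          simp only [Set.Finite.coe_toFinset] at hg
          simpa using (update_mem_predFun_succ (hg.2.1 n le_rfl) hxn hA' hB').2 ⟨hi, hg⟩
        · intro f hf
          simp only [Finset.coe_filter, Set.Finite.mem_toFinset, Set.mem_ofPred_eq] at hf
          simp [← hf.2]
        · intro g hg
          simp only [Set.Finite.coe_toFinset] at hg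
          have := hg.2.1 n le_rfl
          dsimp only
          rw [Function.update_idem]
          exact Function.update_eq_self_iff.2 this.symm
      · rw [Finset.card_eq_zero, Finset.filter_eq_empty_iff]
        intro f hf hn
        exact hi (key f (by simpa using hf) hn).1
  · intro f hf
    simp only [Set.Finite.coe_toFinset] at hf
    have := hf.1 n
    simpa using by omega

/-- The ballot condition for the rows of a two-row standard tableau. -/
def IsBallot (A B : Finset ℕ) : Prop :=
  ∀ k, (B.filter (· < k)).card ≤ (A.filter (· < k)).card

open Classical in
/-- Standard tableaux with at most two rows and entries in `[0, n)`; the shape `(a, b)` is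
encoded by the point `(a + 1, b)`. -/
noncomputable def tableaux (n : ℕ) (p : ℤ × ℤ) : Finset (Finset ℕ × Finset ℕ) :=
  ((Finset.range n).powerset ×ˢ (Finset.range n).powerset).filter fun T =>
    Disjoint T.1 T.2 ∧ IsBallot T.1 T.2 ∧ ((T.1.card : ℤ) + 1, (T.2.card : ℤ)) = p

theorem mem_tableaux {n : ℕ} {p : ℤ × ℤ} {A B : Finset ℕ} :
    (A, B) ∈ tableaux n p ↔ (∀ a ∈ A, a < n) ∧ (∀ b ∈ B, b < n) ∧ (∀ a ∈ A, a ∉ B) ∧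
      IsBallot A B ∧ (A.card : ℤ) + 1 = p.1 ∧ (B.card : ℤ) = p.2 := by
  simp [tableaux, Finset.subset_iff, Finset.disjoint_left, Prod.ext_iff, and_assoc]

theorem filter_lt_eq_self {A : Finset ℕ} {k : ℕ} (h : ∀ a ∈ A, a < k) :
    A.filter (· < k) = A :=
  Finset.filter_true_of_mem h

theorem IsBallot.card_le {A B : Finset ℕ} (h : IsBallot A B) : B.card ≤ A.card := by
  have := h (((A ∪ B).sup id) + 1)
  have hle : ∀ a ∈ A ∪ B, a < (A ∪ B).sup id + 1 := fun a ha =>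
    Nat.lt_succ_of_le (Finset.le_sup (f := id) ha)
  rwa [filter_lt_eq_self fun a ha => hle a (Finset.mem_union_right _ ha),
    filter_lt_eq_self fun a ha => hle a (Finset.mem_union_left _ ha)] at this

theorem IsBallot.mono {A B A' B' : Finset ℕ} (h : IsBallot A B) (hA : A ⊆ A') (hB : B' ⊆ B) :
    IsBallot A' B' := fun k =>
  (Finset.card_le_card (Finset.filter_subset_filter _ hB)).trans
    ((h k).trans (Finset.card_le_card (Finset.filter_subset_filter _ hA)))

theorem mem_W2_of_mem_tableaux {n : ℕ} {p : ℤ × ℤ} {T : Finset ℕ × Finset ℕ}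
    (h : T ∈ tableaux n p) : p ∈ W2 := by
  obtain ⟨A, B⟩ := T
  obtain ⟨-, -, -, hb, h1, h2⟩ := mem_tableaux.1 h
  have := hb.card_le
  simp only [W2, Set.mem_ofPred_eq]
  omega

/-- Adding the largest entry to the second row. -/
theorem IsBallot.insert_right {A B : Finset ℕ} {n : ℕ} (h : IsBallot A B) (hA : ∀ a ∈ A, a ≤ n)
    (hc : B.card < A.card) : IsBallot A (insert n B) := by
  intro k
  rcases le_or_gt k n with hk | hk
  · rw [Finset.filter_insert, if_neg (by omega)]
    exact h k
  · rw [filter_lt_eq_self (A := A) fun a ha => (hA a ha).trans_lt hk]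
    exact (Finset.card_filter_le _ _).trans ((Finset.card_insert_le _ _).trans hc)

/-- Removing the largest entry from the first row. -/
theorem IsBallot.erase_left {A B : Finset ℕ} {n : ℕ} (h : IsBallot A B) (hA : ∀ a ∈ A, a ≤ n)
    (hc : B.card < A.card) : IsBallot (A.erase n) B := by
  intro k
  rcases le_or_gt k n with hk | hk
  · rw [show (A.erase n).filter (· < k) = A.filter (· < k) by grind]
    exact h k
  · rw [filter_lt_eq_self (A := A.erase n) fun a ha =>
      (hA a (Finset.mem_of_mem_erase ha)).trans_lt hk]
    have := Finset.pred_card_le_card_erase (s := A) (a := n)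
    have := Finset.card_filter_le B (· < k)
    omega

theorem sum_tableaux_succ (F : Finset ℕ × Finset ℕ → ℕ) (n : ℕ) {p : ℤ × ℤ} (hp : p ∈ W2) :
    ∑ T ∈ tableaux (n + 1) p, F (T.1.erase n, T.2.erase n) =
      ∑ T ∈ tableaux n (p - (1, 0)), F T + ∑ T ∈ tableaux n (p - (0, 1)), F T +
        ∑ T ∈ tableaux n p, F T := by
  obtain ⟨p1, p2⟩ := p
  simp only [W2, Set.mem_ofPred_eq] at hp
  rw [← Finset.sum_filter_add_sum_filter_not _ (fun T => n ∈ T.1), add_assoc,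
    ← Finset.sum_filter_add_sum_filter_not
      ((tableaux (n + 1) (p1, p2)).filter fun T => n ∉ T.1) (fun T => n ∈ T.2)]
  congr 1
  · refine Finset.sum_nbij' (fun T => (T.1.erase n, T.2)) (fun T => (insert n T.1, T.2))
      ?_ ?_ ?_ ?_ ?_
    · rintro ⟨A, B⟩ hT
      obtain ⟨hT, hn⟩ := Finset.mem_filter.1 hT
      obtain ⟨h1, h2, h3, h4, h5, h6⟩ := mem_tableaux.1 hT
      dsimp only at *
      have := Finset.card_erase_add_one hn
      have hlt : B.card < A.card := by
        have h4n := h4 n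
        rw [filter_lt_eq_self (A := B) (by grind),
          show A.filter (· < n) = A.erase n by grind] at h4n
        omega
      refine mem_tableaux.2 ⟨by grind, by grind, by grind,
        h4.erase_left (fun a ha => Nat.le_of_lt_succ (h1 a ha)) hlt, ?_, ?_⟩
      · simp; omega
      · simp; omega
    · rintro ⟨A, B⟩ hT
      obtain ⟨h1, h2, h3, h4, h5, h6⟩ := mem_tableaux.1 hT
      have hnA : n ∉ A := fun h => (h1 n h).false
      simp only [Prod.mk_sub_mk] at h5 h6
      refine Finset.mem_filter.2 ⟨mem_tableaux.2 ⟨by grind, by grind, by grind,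
        h4.mono (Finset.subset_insert _ _) subset_rfl, ?_, ?_⟩, by simp⟩
      · simp [Finset.card_insert_of_notMem hnA]; omega
      · simp; omega
    · rintro ⟨A, B⟩ hT
      simp [Finset.insert_erase (Finset.mem_filter.1 hT).2]
    · rintro ⟨A, B⟩ hT
      have hnA : n ∉ A := fun h => ((mem_tableaux.1 hT).1 n h).false
      simp [Finset.erase_insert hnA]
    · rintro ⟨A, B⟩ hT
      obtain ⟨hT, hn⟩ := Finset.mem_filter.1 hT
      have hnB : n ∉ B := (mem_tableaux.1 hT).2.2.1 n hn
      simp [Finset.erase_eq_of_notMem hnB]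
  congr 1
  · refine Finset.sum_nbij' (fun T => (T.1, T.2.erase n)) (fun T => (T.1, insert n T.2))
      ?_ ?_ ?_ ?_ ?_
    · rintro ⟨A, B⟩ hT
      obtain ⟨hT, hnB⟩ := Finset.mem_filter.1 hT
      obtain ⟨hT, hnA⟩ := Finset.mem_filter.1 hT
      obtain ⟨h1, h2, h3, h4, h5, h6⟩ := mem_tableaux.1 hT
      dsimp only at *
      have := Finset.card_erase_add_one hnB
      refine mem_tableaux.2 ⟨by grind, by grind, by grind,
        h4.mono subset_rfl (Finset.erase_subset _ _), ?_, ?_⟩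
      · simp; omega
      · simp; omega
    · rintro ⟨A, B⟩ hT
      obtain ⟨h1, h2, h3, h4, h5, h6⟩ := mem_tableaux.1 hT
      have hnA : n ∉ A := fun h => (h1 n h).false
      have hnB : n ∉ B := fun h => (h2 n h).false
      simp only [Prod.mk_sub_mk] at h5 h6
      refine Finset.mem_filter.2 ⟨Finset.mem_filter.2 ⟨mem_tableaux.2 ⟨by grind, by grind, by grind,
        h4.insert_right (fun a ha => (h1 a ha).le) (by omega), ?_, ?_⟩, hnA⟩, by simp⟩
      · simp; omega
      · simp [Finset.card_insert_of_notMem hnB]; omega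
    · rintro ⟨A, B⟩ hT
      simp [Finset.insert_erase (Finset.mem_filter.1 hT).2]
    · rintro ⟨A, B⟩ hT
      have hnB : n ∉ B := fun h => ((mem_tableaux.1 hT).2.1 n h).false
      simp [Finset.erase_insert hnB]
    · rintro ⟨A, B⟩ hT
      have hnA := (Finset.mem_filter.1 (Finset.mem_filter.1 hT).1).2
      simp [Finset.erase_eq_of_notMem hnA]
  · refine Finset.sum_congr ?_ ?_
    · ext ⟨A, B⟩
      simp only [Finset.mem_filter, mem_tableaux]
      constructor
      · rintro ⟨⟨⟨h1, h2, h3⟩, h4⟩, h5⟩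
        exact ⟨by grind, by grind, h3⟩
      · rintro ⟨h1, h2, h3⟩
        exact ⟨⟨⟨by grind, by grind, h3⟩, by grind⟩, by grind⟩
    · rintro ⟨A, B⟩ hT
      obtain ⟨h1, h2, -⟩ := mem_tableaux.1 hT
      rw [Finset.erase_eq_of_notMem fun h => (h1 n h).false,
        Finset.erase_eq_of_notMem fun h => (h2 n h).false]

theorem rowInsert_mem_tableaux {n x : ℕ} {p : ℤ × ℤ} {T : Finset ℕ × Finset ℕ}
    (hT : T ∈ tableaux n p) (hxn : x < n) (hx : Insertable x T.1 T.2) :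
    rowInsert x T ∈ tableaux n (p + (1, 0)) ∨ rowInsert x T ∈ tableaux n (p + (0, 1)) := by
  obtain ⟨A, B⟩ := T
  obtain ⟨h1, h2, h3, h4, h5, h6⟩ := mem_tableaux.1 hT
  obtain ⟨hxA, hxB, hok⟩ := hx
  dsimp only at hxA hxB hok
  rcases rowInsert_cases x A B with ⟨h, e⟩ | ⟨y, hy, hxy, hm, e⟩
  · left
    rw [e]
    refine mem_tableaux.2 ⟨by grind, by grind, by grind,
      h4.mono (Finset.subset_insert _ _) subset_rfl, ?_, by simpa using h6⟩
    simp [Finset.card_insert_of_notMem hxA]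
    omega
  · right
    rw [e]
    have hyB := h3 y hy
    have hBy : ∀ d ∈ B, d < y := fun d hd =>
      lt_of_le_of_ne (hok y hy d hd hxy) fun h => hyB (h ▸ hd)
    have hcard : ((insert x A).erase y).card = A.card := by
      rw [Finset.card_erase_of_mem (by simp [hy]), Finset.card_insert_of_notMem hxA]
      simp
    refine mem_tableaux.2 ⟨by grind, by grind, by grind, fun k => ?_, ?_, ?_⟩
    · rcases le_or_gt k y with hk | hk
      · refine le_trans ?_ ((h4 k).trans (Finset.card_le_card ?_))
        · refine Finset.card_le_card ?_
          grind
        · grind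
      · have e1 : (insert y B).filter (· < k) = insert y B := by grind
        have e2 : insert x (A.filter (· < y)) ⊆ ((insert x A).erase y).filter (· < k) := by grind
        have := Finset.card_le_card e2
        have h4y := h4 y
        rw [filter_lt_eq_self hBy] at h4y
        rw [Finset.card_insert_of_notMem (by grind)] at this
        rw [e1, Finset.card_insert_of_notMem hyB]
        omega
    · rw [hcard]
      simpa using h5
    · rw [Finset.card_insert_of_notMem hyB]
      simp
      omega

theorem rowInsert_injOn {n x z : ℕ} {p : ℤ × ℤ} {S T : Finset ℕ × Finset ℕ}
    (hS : S ∈ tableaux n p) (hz : Insertable z S.1 S.2) (hT : T ∈ tableaux n p)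
    (hx : Insertable x T.1 T.2) (h : rowInsert x T = rowInsert z S) : T = S ∧ x = z := by
  obtain ⟨A, B⟩ := T
  obtain ⟨A', B'⟩ := S
  obtain ⟨-, -, h3, -, h5, h6⟩ := mem_tableaux.1 hT
  obtain ⟨-, -, h3', -, h5', h6'⟩ := mem_tableaux.1 hS
  obtain ⟨hxA, hxB, hok⟩ := hx
  obtain ⟨hzA, hzB, hok'⟩ := hz
  dsimp only at hxA hxB hok hzA hzB hok'
  have ins_cancel : ∀ {u : ℕ} {C D : Finset ℕ}, u ∉ C → u ∉ D → insert u C = insert u D →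
      C = D := fun hC hD e => by
    rw [← Finset.erase_insert hC, e, Finset.erase_insert hD]
  rcases rowInsert_cases x A B with ⟨hm, e⟩ | ⟨y, hy, hxy, hm, e⟩ <;>
    rcases rowInsert_cases z A' B' with ⟨hm', e'⟩ | ⟨y', hy', hxy', hm', e'⟩ <;>
    rw [e, e'] at h <;> obtain ⟨k1, k2⟩ := Prod.mk.inj h
  · have hxz : x = z := by
      have m1 : x ∈ insert z A' := k1 ▸ Finset.mem_insert_self x A
      have m2 : z ∈ insert x A := k1 ▸ Finset.mem_insert_self z A'
      have := hm z
      have := hm' x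
      grind
    subst hxz
    exact ⟨Prod.ext (ins_cancel hxA hzA k1) k2, rfl⟩
  · have := congrArg Finset.card k2
    rw [Finset.card_insert_of_notMem (h3' y' hy')] at this
    omega
  · have := congrArg Finset.card k2
    rw [Finset.card_insert_of_notMem (h3 y hy)] at this
    omega
  · have hyB := h3 y hy
    have hyB' := h3' y' hy'
    have hyy : y = y' := by
      have m1 : y ∈ insert y' B' := k2 ▸ Finset.mem_insert_self y B
      have m2 : y' ∈ insert y B := k2 ▸ Finset.mem_insert_self y' B'
      have := hok y hy y'
      have := hok' y' hy' y
      grind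
    subst hyy
    have k3 : insert x A = insert z A' := by
      rw [← Finset.insert_erase (show y ∈ insert x A by simp [hy]), k1,
        Finset.insert_erase (by simp [hy'])]
    have hxz : x = z := by
      have m1 : x ∈ insert z A' := k3 ▸ Finset.mem_insert_self x A
      have m2 : z ∈ insert x A := k3 ▸ Finset.mem_insert_self z A'
      have := hm z
      have := hm' x
      grind
    subst hxz
    exact ⟨Prod.ext (ins_cancel hxA hzA k3) (ins_cancel hyB hyB' k2), rfl⟩

/-- Reverse row insertion at the corner of the first row. -/
theorem exists_rowInsert_of_mem_left {n : ℕ} {p : ℤ × ℤ} (hp : p ∈ W2)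
    {T : Finset ℕ × Finset ℕ} (hT : T ∈ tableaux n (p + (1, 0))) :
    ∃ S ∈ tableaux n p, ∃ x < n, Insertable x S.1 S.2 ∧ rowInsert x S = T := by
  obtain ⟨A, B⟩ := T
  obtain ⟨h1, h2, h3, h4, h5, h6⟩ := mem_tableaux.1 hT
  simp only [W2, Set.mem_ofPred_eq] at hp
  simp only [Prod.fst_add, Prod.snd_add] at h5 h6
  have hne : A.Nonempty := Finset.card_pos.1 (by omega)
  obtain ⟨x, hxA, hmax⟩ := Finset.exists_max_image A id hne
  simp only [id] at hmax
  have hcard := Finset.card_erase_add_one hxA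
  refine ⟨(A.erase x, B), mem_tableaux.2 ⟨by grind, h2, by grind,
    h4.erase_left hmax (by omega), by omega, by omega⟩, x, h1 x hxA,
    ⟨by simp, h3 x hxA, fun c hc d hd hxc => ?_⟩, ?_⟩
  · have := hmax c (Finset.mem_of_mem_erase hc)
    omega
  · rcases rowInsert_cases x (A.erase x) B with ⟨hm, e⟩ | ⟨y, hy, hxy, hm, e⟩
    · rw [e, Finset.insert_erase hxA]
    · have := hmax y (Finset.mem_of_mem_erase hy)
      omega

/-- Reverse row insertion at the corner of the second row. -/
theorem exists_rowInsert_of_mem_right {n : ℕ} {p : ℤ × ℤ} (hp : p ∈ W2)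
    {T : Finset ℕ × Finset ℕ} (hT : T ∈ tableaux n (p + (0, 1))) :
    ∃ S ∈ tableaux n p, ∃ x < n, Insertable x S.1 S.2 ∧ rowInsert x S = T := by
  obtain ⟨A, B⟩ := T
  obtain ⟨h1, h2, h3, h4, h5, h6⟩ := mem_tableaux.1 hT
  simp only [W2, Set.mem_ofPred_eq] at hp
  simp only [Prod.fst_add, Prod.snd_add] at h5 h6
  have hne : B.Nonempty := Finset.card_pos.1 (by omega)
  obtain ⟨y, hyB, hymax⟩ := Finset.exists_max_image B id hne
  simp only [id] at hymax
  have hyA : y ∉ A := fun h => h3 y h hyB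
  have hbal : B.card ≤ (A.filter (· < y)).card := by
    have := h4 (y + 1)
    rw [filter_lt_eq_self fun b hb => Nat.lt_succ_of_le (hymax b hb)] at this
    refine this.trans (Finset.card_le_card ?_)
    grind
  have hne' : (A.filter (· < y)).Nonempty := Finset.card_pos.1 (by omega)
  obtain ⟨x, hx, hxmax⟩ := Finset.exists_max_image _ id hne'
  obtain ⟨hxA, hxy⟩ := Finset.mem_filter.1 hx
  simp only [id, Finset.mem_filter] at hxmax
  have hcB := Finset.card_erase_add_one hyB
  have hcA := Finset.card_erase_add_one hxA
  have hyA' : y ∉ A.erase x := fun h => hyA (Finset.mem_of_mem_erase h)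
  refine ⟨(insert y (A.erase x), B.erase y), mem_tableaux.2 ⟨by grind, by grind, by grind,
    fun k => ?_, ?_, by omega⟩, x, h1 x hxA, ⟨by grind, by grind, fun c hc d hd hxc => ?_⟩, ?_⟩
  · rcases le_or_gt k x with hk | hk
    · refine le_trans (Finset.card_le_card ?_) ((h4 k).trans (Finset.card_le_card ?_)) <;> grind
    rcases le_or_gt k y with hky | hky
    · have e1 : (A.filter (· < y)).erase x ⊆ (insert y (A.erase x)).filter (· < k) := by
        intro a ha
        have := hxmax a
        grind
      have := Finset.card_le_card e1
      have := Finset.card_erase_add_one hx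
      have := Finset.card_filter_le (B.erase y) (· < k)
      omega
    · have e1 : (insert y (A.erase x)).filter (· < k) =
          insert y ((A.filter (· < k)).erase x) := by grind
      have := Finset.card_erase_add_one (s := A.filter (· < k)) (a := x) (by grind)
      rw [e1, Finset.card_insert_of_notMem (by grind), this]
      refine le_trans (Finset.card_le_card ?_) (h4 k)
      grind
  · rw [Finset.card_insert_of_notMem hyA']
    omega
  · have := hymax d (Finset.mem_of_mem_erase hd)
    have := hxmax c
    grind
  · rcases rowInsert_cases x (insert y (A.erase x)) (B.erase y) with
      ⟨hm, e⟩ | ⟨y', hy', hxy', hm, e⟩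
    · have := hm y (Finset.mem_insert_self _ _)
      omega
    · obtain rfl : y' = y := by
        have := hm y (Finset.mem_insert_self _ _) hxy
        have := hxmax y'
        grind
      rw [e, Finset.insert_erase hyB]
      congr 1
      grind

open Classical in
theorem sum_rowInsert (F : Finset ℕ × Finset ℕ → ℕ) (n : ℕ) {p : ℤ × ℤ} (hp : p ∈ W2) :
    ∑ T ∈ tableaux n p, ∑ x ∈ (Finset.range n).filter (fun x => Insertable x T.1 T.2),
        F (rowInsert x T) =
      ∑ T ∈ tableaux n (p + (1, 0)), F T + ∑ T ∈ tableaux n (p + (0, 1)), F T := by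
  rw [← Finset.sum_union, Finset.sum_sigma']
  · refine Finset.sum_bij (fun Tx _ => rowInsert Tx.2 Tx.1) ?_ ?_ ?_ (fun _ _ => rfl)
    · rintro ⟨T, x⟩ h
      simp only [Finset.mem_sigma, Finset.mem_filter, Finset.mem_range] at h
      exact Finset.mem_union.2 (rowInsert_mem_tableaux h.1 h.2.1 h.2.2)
    · rintro ⟨T, x⟩ h ⟨S, z⟩ h' e
      simp only [Finset.mem_sigma, Finset.mem_filter, Finset.mem_range] at h h'
      obtain ⟨rfl, rfl⟩ := rowInsert_injOn h'.1 h'.2.2 h.1 h.2.2 e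
      rfl
    · intro T hT
      obtain ⟨S, hS, x, hx, hi, e⟩ := (Finset.mem_union.1 hT).elim
        (exists_rowInsert_of_mem_left hp) (exists_rowInsert_of_mem_right hp)
      exact ⟨⟨S, x⟩, by simp [hS, hx, hi], e⟩
  · refine Finset.disjoint_left.2 ?_
    rintro ⟨A, B⟩ h h'
    have h1 := (mem_tableaux.1 h).2.2.2.2.2
    have h2 := (mem_tableaux.1 h').2.2.2.2.2
    simp only [Prod.snd_add] at h1 h2
    omega

theorem sum_predCount_eq_omegaW (n : ℕ) (p : ℤ × ℤ) :
    ∑ T ∈ tableaux n p, predCount n T = omegaW (2 * n) p := by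
  classical
  induction n generalizing p with
  | zero =>
    rw [Nat.mul_zero, omegaW_zero]
    have hT : ∀ T ∈ tableaux 0 p, T = (∅, ∅) := by
      rintro ⟨A, B⟩ h
      obtain ⟨h1, h2, -⟩ := mem_tableaux.1 h
      simp [Finset.eq_empty_iff_forall_notMem]
      exact ⟨fun a ha => by simpa using h1 a ha, fun a ha => by simpa using h2 a ha⟩
    split_ifs with hp
    · subst hp
      have : tableaux 0 (1, 0) = {(∅, ∅)} := by
        refine Finset.eq_singleton_iff_unique_mem.2 ⟨mem_tableaux.2 ?_, hT⟩
        simp [IsBallot]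
      rw [this, Finset.sum_singleton, predCount, Set.ncard_eq_one]
      refine ⟨fun j => j, Set.eq_singleton_iff_unique_mem.2 ⟨?_, fun f hf => ?_⟩⟩
      · refine ⟨fun _ => le_rfl, fun _ _ => rfl, ?_, ?_, ?_, ?_, ?_⟩ <;> simp
        intros
        omega
      · exact funext fun j => hf.2.1 j (Nat.zero_le _)
    · refine Finset.sum_eq_zero fun T h => absurd ?_ hp
      obtain rfl := hT T h
      have := (mem_tableaux.1 h).2.2.2.2
      simp only [Finset.card_empty] at this
      exact Prod.ext this.1.symm this.2.symm
  | succ n ih =>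
    by_cases hp : p ∈ W2
    swap
    · rw [omegaW_of_notMem _ hp]
      exact Finset.sum_eq_zero fun T h => absurd (mem_W2_of_mem_tableaux h) hp
    set F : Finset ℕ × Finset ℕ → ℕ := fun T => predCount n T +
      ∑ x ∈ (Finset.range n).filter (fun x => Insertable x T.1 T.2), predCount n (rowInsert x T)
      with hF
    have hmid : ∀ q : ℤ × ℤ, ∑ T ∈ tableaux n q, F T = omegaW (2 * n + 1) q := by
      intro q
      by_cases hq : q ∈ W2
      · have hs : walkSteps (2 * n + 1) = {(-1, 0), (0, -1), (0, 0)} := by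
          simp [walkSteps]
        rw [hF, Finset.sum_add_distrib, sum_rowInsert _ n hq, omegaW_succ _ hq, hs, ih, ih, ih]
        have e1 : q - (-1, 0) = q + (1, 0) := by ext <;> simp
        have e2 : q - (0, -1) = q + (0, 1) := by ext <;> simp
        have e3 : q - (0, 0) = q := by ext <;> simp
        rw [Finset.sum_insert (by decide), Finset.sum_insert (by decide), Finset.sum_singleton,
          e1, e2, e3]
        ring
      · rw [omegaW_of_notMem _ hq]
        exact Finset.sum_eq_zero fun T h => absurd (mem_W2_of_mem_tableaux h) hq
    have hs : walkSteps (2 * n + 1 + 1) = {(1, 0), (0, 1), (0, 0)} := by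
      simp [walkSteps]; omega
    have e3 : p - (0, 0) = p := by ext <;> simp
    rw [show 2 * (n + 1) = 2 * n + 1 + 1 by ring, omegaW_succ _ hp, hs,
      Finset.sum_insert (by decide), Finset.sum_insert (by decide), Finset.sum_singleton, e3,
      ← hmid, ← hmid, ← hmid, ← add_assoc, ← sum_tableaux_succ F n hp]
    refine Finset.sum_congr rfl ?_
    rintro ⟨A, B⟩ hT
    obtain ⟨h1, h2, -⟩ := mem_tableaux.1 hT
    exact predCount_succ h1 h2

theorem predCount_empty (N : ℕ) : predCount N (∅, ∅) = omegaW (2 * N) (1, 0) := by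
  rw [← sum_predCount_eq_omegaW, Finset.sum_eq_single_of_mem]
  · exact mem_tableaux.2 (by simp [IsBallot])
  · rintro ⟨A, B⟩ hT hne
    have := (mem_tableaux.1 hT).2.2.2.2
    simp only [add_eq_right, Nat.cast_eq_zero, Finset.card_eq_zero] at this
    exact absurd (Prod.ext this.1 this.2) hne

/-- The first element of the block of `j`, found by following predecessors. -/
def blockMin (f : ℕ → ℕ) (j : ℕ) : ℕ :=
  if f j < j then blockMin f (f j) else j
termination_by j

theorem blockMin_of_lt {f : ℕ → ℕ} {j : ℕ} (h : f j < j) : blockMin f j = blockMin f (f j) := by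
  rw [blockMin, if_pos h]

theorem blockMin_of_not_lt {f : ℕ → ℕ} {j : ℕ} (h : ¬ f j < j) : blockMin f j = j := by
  rw [blockMin, if_neg h]

theorem blockMin_le (f : ℕ → ℕ) (j : ℕ) : blockMin f j ≤ j := by
  induction j using Nat.strong_induction_on with
  | _ j ih =>
    by_cases h : f j < j
    · rw [blockMin_of_lt h]
      exact (ih _ h).trans h.le
    · rw [blockMin_of_not_lt h]

/-- Every non-final element of a block is the predecessor of an element of the block. -/
theorem exists_succ_of_blockMin_eq {f : ℕ → ℕ}
    (hinj : ∀ i j, f i < i → f j < j → f i = f j → i = j) {i j : ℕ} (hij : i < j)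
    (h : blockMin f i = blockMin f j) : ∃ k, i < k ∧ k ≤ j ∧ f k = i := by
  induction j using Nat.strong_induction_on generalizing i with
  | _ j ih =>
    by_cases hj : f j < j
    · rw [blockMin_of_lt hj] at h
      rcases lt_trichotomy i (f j) with hlt | heq | hgt
      · obtain ⟨k, h1, h2, h3⟩ := ih _ hj hlt h
        exact ⟨k, h1, by omega, h3⟩
      · exact ⟨j, hij, le_rfl, heq.symm⟩
      · obtain ⟨k, h1, h2, h3⟩ := ih _ hij hgt h.symm
        have := hinj k j (by omega) hj h3
        omega
    · rw [blockMin_of_not_lt hj] at h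
      have := blockMin_le f i
      omega

theorem sameBlock_iff_mem_part {N : ℕ} (P : Finpartition (Finset.univ : Finset (Fin N)))
    (i j : Fin N) : SameBlock P i j ↔ j ∈ P.part i := by
  constructor
  · rintro ⟨B, hB, hi, hj⟩
    rwa [P.part_eq_of_mem hB hi]
  · intro h
    exact ⟨P.part i, P.part_mem.2 (Finset.mem_univ i), P.mem_part (Finset.mem_univ i), h⟩

theorem SameBlock.refl {N : ℕ} (P : Finpartition (Finset.univ : Finset (Fin N)))
    (i : Fin N) : SameBlock P i i :=
  (sameBlock_iff_mem_part P i i).2 (P.mem_part (Finset.mem_univ i))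

theorem SameBlock.symm {N : ℕ} {P : Finpartition (Finset.univ : Finset (Fin N))}
    {i j : Fin N} : SameBlock P i j → SameBlock P j i := fun ⟨B, hB, hi, hj⟩ => ⟨B, hB, hj, hi⟩

theorem SameBlock.trans {N : ℕ} {P : Finpartition (Finset.univ : Finset (Fin N))}
    {i j k : Fin N} : SameBlock P i j → SameBlock P j k → SameBlock P i k := by
  rintro ⟨B, hB, hi, hj⟩ ⟨C, hC, hj', hk⟩
  obtain rfl := P.eq_of_mem_parts hB hC hj hj'
  exact ⟨B, hB, hi, hk⟩

theorem finpartition_ext_sameBlock {N : ℕ} {P Q : Finpartition (Finset.univ : Finset (Fin N))}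
    (h : ∀ i j, SameBlock P i j ↔ SameBlock Q i j) : P = Q := by
  have hpart : ∀ i, P.part i = Q.part i := fun i => by
    ext j
    rw [← sameBlock_iff_mem_part, ← sameBlock_iff_mem_part, h]
  have hle : ∀ {P Q : Finpartition (Finset.univ : Finset (Fin N))},
      (∀ i, P.part i = Q.part i) → P.parts ⊆ Q.parts := by
    intro P Q h B hB
    obtain ⟨i, hi⟩ := P.nonempty_of_mem_parts hB
    rw [← P.part_eq_of_mem hB hi, h]
    exact Q.part_mem.2 (Finset.mem_univ i)
  exact Finpartition.ext ((hle hpart).antisymm (hle fun i => (hpart i).symm))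

open Classical in
/-- The set partition of `[N]` whose arcs are the pairs `(f j, j)` with `f j < j`. -/
noncomputable def predPartition (N : ℕ) (f : ℕ → ℕ) :
    Finpartition (Finset.univ : Finset (Fin N)) :=
  Finpartition.ofSetoid (Setoid.ker fun i : Fin N => blockMin f i)

theorem sameBlock_predPartition {N : ℕ} {f : ℕ → ℕ} {i j : Fin N} :
    SameBlock (predPartition N f) i j ↔ blockMin f i = blockMin f j := by
  classical
  rw [sameBlock_iff_mem_part, predPartition, Finpartition.mem_part_ofSetoid_iff_rel]
  rfl

/-- Predecessor functions of arbitrary partitions of `[N]`. -/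
def IsPred (N : ℕ) (f : ℕ → ℕ) : Prop :=
  (∀ j, f j ≤ j) ∧ (∀ j, N ≤ j → f j = j) ∧ ∀ i j, f i < i → f j < j → f i = f j → i = j

theorem isArc_predPartition {N : ℕ} {f : ℕ → ℕ} (hf : IsPred N f) {i j : Fin N} :
    IsArc (predPartition N f) i j ↔ i < j ∧ f j = i := by
  obtain ⟨hle, -, hinj⟩ := hf
  constructor
  · rintro ⟨hij, hs, hno⟩
    refine ⟨hij, ?_⟩
    obtain ⟨k, h1, h2, h3⟩ := exists_succ_of_blockMin_eq hinj hij (sameBlock_predPartition.1 hs)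
    rcases h2.eq_or_lt with rfl | hlt
    · exact h3
    · refine absurd ?_ (hno ⟨k, hlt.trans j.2⟩ h1 hlt)
      rw [sameBlock_predPartition]
      dsimp only
      rw [blockMin_of_lt (j := k) (by omega), h3]
  · rintro ⟨hij, hj⟩
    have hlt : f j < j := by rw [hj]; exact hij
    refine ⟨hij, ?_, fun l hil hlj hs => ?_⟩
    · rw [sameBlock_predPartition, blockMin_of_lt hlt, hj]
    · obtain ⟨k, h1, h2, h3⟩ := exists_succ_of_blockMin_eq hinj hil (sameBlock_predPartition.1 hs)
      have := hinj k j (by omega) hlt (by omega)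
      have : (l : ℕ) < j := hlj
      omega

theorem predPartition_injOn {N : ℕ} {f g : ℕ → ℕ} (hf : IsPred N f) (hg : IsPred N g)
    (h : predPartition N f = predPartition N g) : f = g := by
  have key : ∀ {f g : ℕ → ℕ}, IsPred N f → IsPred N g →
      predPartition N f = predPartition N g → ∀ j, f j < j → g j = f j := by
    intro f g hf hg h j hj
    have hjN : j < N := by
      by_contra hN
      have := hf.2.1 j (by omega)
      omega
    have harc := (isArc_predPartition hf (i := ⟨f j, hj.trans hjN⟩) (j := ⟨j, hjN⟩)).2 ⟨hj, rfl⟩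
    rw [h] at harc
    exact ((isArc_predPartition hg).1 harc).2
  funext j
  rcases (hf.1 j).lt_or_eq with hj | hj
  · exact (key hf hg h j hj).symm
  rcases (hg.1 j).lt_or_eq with hj' | hj'
  · exact key hg hf h.symm j hj'
  · rw [hj, hj']

theorem exists_predPartition_eq {N : ℕ} (P : Finpartition (Finset.univ : Finset (Fin N))) :
    ∃ f, IsPred N f ∧ predPartition N f = P := by
  classical
  let R : ℕ → ℕ → Prop := fun j i => ∃ (hj : j < N) (hi : i < N), IsArc P ⟨i, hi⟩ ⟨j, hj⟩
  have hRlt : ∀ {j i}, R j i → i < j := fun ⟨_, _, h⟩ => h.1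
  let f : ℕ → ℕ := fun j => if h : ∃ i, R j i then h.choose else j
  have hfR : ∀ j, f j < j → R j (f j) := by
    intro j hj
    by_cases h : ∃ i, R j i
    · simpa only [f, dif_pos h] using h.choose_spec
    · simp only [f, dif_neg h] at hj
      omega
  have hf : IsPred N f := by
    refine ⟨fun j => ?_, fun j hj => ?_, fun i j hi hj hij => ?_⟩
    · by_cases h : ∃ i, R j i
      · simpa only [f, dif_pos h] using (hRlt h.choose_spec).le
      · simp only [f, dif_neg h, le_refl]
    · have h : ¬ ∃ i, R j i := fun ⟨i, hj', _⟩ => by omega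
      simp only [f, dif_neg h]
    · obtain ⟨h1, h2, ha⟩ := hfR i hi
      obtain ⟨h3, h4, hb⟩ := hfR j hj
      simp only [hij] at ha
      rcases lt_trichotomy i j with hlt | heq | hgt
      · exact absurd ha.2.1 (hb.2.2 ⟨i, h1⟩ ha.1 hlt)
      · exact heq
      · exact absurd hb.2.1 (ha.2.2 ⟨j, h3⟩ hb.1 hgt)
  refine ⟨f, hf, finpartition_ext_sameBlock fun a b => ?_⟩
  rw [sameBlock_predPartition]
  have hmin : ∀ j (hj : j < N),
      SameBlock P ⟨blockMin f j, (blockMin_le f j).trans_lt hj⟩ ⟨j, hj⟩ := by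
    intro j
    induction j using Nat.strong_induction_on with
    | _ j ih =>
      intro hj
      by_cases h : f j < j
      · obtain ⟨_, _, ha⟩ := hfR j h
        simp only [blockMin_of_lt h]
        exact (ih (f j) h (h.trans hj)).trans ha.2.1
      · simp only [blockMin_of_not_lt h]
        exact SameBlock.refl _ _
  constructor
  · intro h
    have ha := hmin a a.2
    have hb := hmin b b.2
    simp only [← h] at hb
    exact ha.symm.trans hb
  · have key : ∀ j (hj : j < N) i (hi : i < N), i < j → SameBlock P ⟨i, hi⟩ ⟨j, hj⟩ →
        blockMin f i = blockMin f j := by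
      intro j
      induction j using Nat.strong_induction_on with
      | _ j ih =>
        intro hj i hi hij hs
        obtain ⟨m, hm, hmax⟩ := Finset.exists_max_image
          (Finset.univ.filter fun l : Fin N => l < ⟨j, hj⟩ ∧ SameBlock P l ⟨j, hj⟩) id
          ⟨⟨i, hi⟩, by simpa using ⟨hij, hs⟩⟩
        simp only [Finset.mem_filter, Finset.mem_univ, true_and, id] at hm hmax
        have harc : IsArc P m ⟨j, hj⟩ :=
          ⟨hm.1, hm.2, fun l h1 h2 h3 =>
            absurd (hmax l ⟨h2, h3.symm.trans hm.2⟩) (not_le.2 h1)⟩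
        have hex : ∃ i, R j i := ⟨m, hj, m.2, harc⟩
        have hlt : f j < j := by
          simpa only [f, dif_pos hex] using hRlt hex.choose_spec
        obtain ⟨_, hfN, harc'⟩ := hfR j hlt
        rw [blockMin_of_lt hlt]
        have hle : i ≤ f j := by
          by_contra hgt
          exact harc'.2.2 ⟨i, hi⟩ (not_le.1 hgt) hij (harc'.2.1.trans hs.symm)
        rcases hle.eq_or_lt with h | h
        · rw [← h]
        · exact ih (f j) hlt hfN i hi h (hs.trans harc'.2.1.symm)
    intro h
    rcases lt_trichotomy a b with hlt | heq | hgt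
    · exact key b b.2 a a.2 hlt h
    · rw [heq]
    · exact (key a a.2 b b.2 hgt h.symm).symm

theorem isKNoncrossingPartition_three_predPartition {N : ℕ} {f : ℕ → ℕ} (hf : IsPred N f) :
    IsKNoncrossingPartition 3 (predPartition N f) ↔
      ∀ i j k, i < j → j < k → f i < f j → f j < f k → i ≤ f k := by
  rw [IsKNoncrossingPartition, PartitionHasKCrossing]
  constructor
  · intro h i j k hij hjk h1 h2
    by_contra hlt
    have hkN : k < N := by
      by_contra hN
      have := hf.2.1 k (by omega)
      omega
    refine h ⟨![⟨f i, by omega⟩, ⟨f j, by omega⟩, ⟨f k, by omega⟩],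
      ![⟨i, by omega⟩, ⟨j, by omega⟩, ⟨k, hkN⟩], ?_, ?_, ?_, ?_⟩
    · rw [Fin.strictMono_iff_lt_succ]
      intro m
      fin_cases m <;> simpa
    · rw [Fin.strictMono_iff_lt_succ]
      intro m
      fin_cases m <;> simpa
    · intro m
      rw [isArc_predPartition hf]
      fin_cases m <;> simp <;> omega
    · intro m m'
      fin_cases m <;> fin_cases m' <;> simp <;> omega
  · rintro h ⟨a, b, ha, hb, harc, hlt⟩
    have e : ∀ m, f (b m) = a m := fun m => ((isArc_predPartition hf).1 (harc m)).2
    have a1 : (a 0 : ℕ) < a 1 := ha (by decide)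
    have a2 : (a 1 : ℕ) < a 2 := ha (by decide)
    have b1 : (b 0 : ℕ) < b 1 := hb (by decide)
    have b2 : (b 1 : ℕ) < b 2 := hb (by decide)
    have := h (b 0) (b 1) (b 2) b1 b2 (by rw [e, e]; exact a1) (by rw [e, e]; exact a2)
    rw [e] at this
    have : (a 2 : ℕ) < b 0 := hlt 2 0
    omega

theorem mem_predFun_empty {N : ℕ} {f : ℕ → ℕ} :
    f ∈ PredFun N ∅ ∅ ↔
      IsPred N f ∧ ∀ i j k, i < j → j < k → f i < f j → f j < f k → i ≤ f k := by
  simp [PredFun, IsPred, and_assoc]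

theorem card_isKNoncrossingPartition_three (N : ℕ) :
    Nat.card {P : Finpartition (Finset.univ : Finset (Fin N)) // IsKNoncrossingPartition 3 P} =
      predCount N (∅, ∅) := by
  rw [predCount, ← Nat.card_coe_set_eq]
  refine (Nat.card_eq_of_bijective (fun f : PredFun N ∅ ∅ =>
    (⟨predPartition N f.1, (isKNoncrossingPartition_three_predPartition
      (mem_predFun_empty.1 f.2).1).2 (mem_predFun_empty.1 f.2).2⟩ :
      {P : Finpartition (Finset.univ : Finset (Fin N)) // IsKNoncrossingPartition 3 P}))
    ⟨fun f g h => ?_, fun ⟨P, hP⟩ => ?_⟩).symm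
  · exact Subtype.ext (predPartition_injOn (mem_predFun_empty.1 f.2).1 (mem_predFun_empty.1 g.2).1
      (congrArg Subtype.val h))
  · obtain ⟨f, hf, rfl⟩ := exists_predPartition_eq P
    exact ⟨⟨f, mem_predFun_empty.2
      ⟨hf, (isKNoncrossingPartition_three_predPartition hf).1 hP⟩⟩, rfl⟩

/-- For every `N ≥ 1`, the number of 3-noncrossing set partitions of `[N]`
equals `ω^{1,0}_{2N}`, the number of `𝒫_{W₂}`-walks of length `2N` ending at `(1,0)`. -/
theorem number_of_three_noncrossing_partitions (N : ℕ) (hN : 1 ≤ N) :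
    Nat.card {P : Finpartition (Finset.univ : Finset (Fin N)) //
        IsKNoncrossingPartition 3 P} = omegaW (2 * N) (1, 0) := by
  rw [card_isKNoncrossingPartition_three, predCount_empty]
end

section
/- For every integer N ≥ 1, the number of 3-noncrossing braids over [N] equals σ^{1,0}_{2N}, the number of B_{W2}-walks of length 2N ending at (1,0). -/
/-- The local rule of a growth diagram of shapes with at most two rows.  The corners of the cell are
`l` (bottom left), `m` (bottom right), `n` (top left), `o` (top right), and `x` says that the cell
is filled. -/
def GrowthCell (l m n : ℤ × ℤ) (x : Prop) (o : ℤ × ℤ) : Prop :=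
  (l ∈ W2 ∧ m ∈ W2 ∧ n ∈ W2 ∧ o ∈ W2) ∧
  ((x ∧ m = l ∧ n = l ∧ o = l + (1, 0)) ∨
    (¬ x ∧ m = l ∧ UpStep (n - l) ∧ o = n) ∨
    (¬ x ∧ n = l ∧ UpStep (m - l) ∧ o = m) ∨
    (¬ x ∧ m = l + (1, 0) ∧ n = l + (0, 1) ∧ o = l + (1, 1)) ∨
    (¬ x ∧ m = l + (0, 1) ∧ n = l + (1, 0) ∧ o = l + (1, 1)) ∨
    (¬ x ∧ m = l + (1, 0) ∧ n = l + (1, 0) ∧ o = l + (1, 1)))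

namespace GrowthCell

variable {l m n o l' o' : ℤ × ℤ} {x x' : Prop}

theorem flip (h : GrowthCell l m n x o) : GrowthCell l n m x o := by
  unfold GrowthCell at *
  tauto

theorem upStep_bottom (h : GrowthCell l m n x o) : UpStep (m - l) := by
  obtain ⟨-, h | h | h | h | h | h⟩ := h <;> simp_all [UpStep, Prod.ext_iff]

theorem upStep_top (h : GrowthCell l m n x o) : UpStep (o - n) := by
  obtain ⟨l1, l2⟩ := l
  obtain ⟨-, h | h | h | h | h | h⟩ := h <;> simp_all [UpStep, Prod.ext_iff]

theorem top_eq_of_filled (h : GrowthCell l m n x o) (hx : x) : o = n + (1, 0) := by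
  obtain ⟨-, h | h | h | h | h | h⟩ := h <;> simp_all

theorem bottom_eq_of_filled (h : GrowthCell l m n x o) (hx : x) : m = l := by
  obtain ⟨-, h | h | h | h | h | h⟩ := h <;> simp_all

theorem top_eq_fst_iff (h : GrowthCell l m n x o) :
    o = n + (1, 0) ↔ x ∨ (m = l + (1, 0) ∧ n ≠ l + (1, 0)) := by
  obtain ⟨l1, l2⟩ := l
  obtain ⟨m1, m2⟩ := m
  obtain ⟨n1, n2⟩ := n
  obtain ⟨o1, o2⟩ := o
  obtain ⟨-, h | h | h | h | h | h⟩ := h <;> simp_all [UpStep]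

theorem top_eq_snd_iff (h : GrowthCell l m n x o) :
    o = n + (0, 1) ↔ m = l + (0, 1) ∨ (m = l + (1, 0) ∧ n = l + (1, 0)) := by
  obtain ⟨l1, l2⟩ := l
  obtain ⟨m1, m2⟩ := m
  obtain ⟨n1, n2⟩ := n
  obtain ⟨o1, o2⟩ := o
  obtain ⟨-, h | h | h | h | h | h⟩ := h <;> simp_all [UpStep]

theorem not_both_snd (h : GrowthCell l m n x o) (hm : m = l + (0, 1)) : n ≠ l + (0, 1) := by
  obtain ⟨l1, l2⟩ := l
  obtain ⟨-, h | h | h | h | h | h⟩ := h <;> simp_all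

theorem bottom_eq_of_top_eq (h : GrowthCell l m n x o) (ho : o = n) : m = l := by
  obtain ⟨l1, l2⟩ := l
  obtain ⟨m1, m2⟩ := m
  obtain ⟨n1, n2⟩ := n
  obtain ⟨o1, o2⟩ := o
  obtain ⟨-, h | h | h | h | h | h⟩ := h <;> simp_all [UpStep]

theorem top_right_unique (h : GrowthCell l m n x o) (h' : GrowthCell l m n x' o')
    (hx : x ↔ x') : o = o' := by
  obtain ⟨l1, l2⟩ := l
  obtain ⟨m1, m2⟩ := m
  obtain ⟨n1, n2⟩ := n
  obtain ⟨-, h | h | h | h | h | h⟩ := h <;> obtain ⟨-, h' | h' | h' | h' | h' | h'⟩ := h' <;>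
    simp_all

theorem bottom_left_unique (h : GrowthCell l m n x o) (h' : GrowthCell l' m n x' o) :
    l = l' ∧ (x ↔ x') := by
  obtain ⟨l1, l2⟩ := l
  obtain ⟨l1', l2'⟩ := l'
  obtain ⟨m1, m2⟩ := m
  obtain ⟨n1, n2⟩ := n
  obtain ⟨o1, o2⟩ := o
  obtain ⟨-, h | h | h | h | h | h⟩ := h <;> obtain ⟨-, h' | h' | h' | h' | h' | h'⟩ := h' <;>
    simp_all [UpStep] <;> omega

theorem exists_top_right (hl : l ∈ W2) (hm : m ∈ W2) (hn : n ∈ W2) (hlm : UpStep (m - l))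
    (hln : UpStep (n - l)) (hx : x → m = l ∧ n = l) (hmn : ¬ (m = l + (0, 1) ∧ n = l + (0, 1))) :
    ∃ o, GrowthCell l m n x o := by
  obtain ⟨l1, l2⟩ := l
  obtain ⟨m1, m2⟩ := m
  obtain ⟨n1, n2⟩ := n
  simp only [UpStep, W2, Set.mem_ofPred_eq, Prod.mk_sub_mk, Prod.mk.injEq, Prod.mk_add_mk,
    sub_eq_iff_eq_add] at *
  by_cases h : x
  · refine ⟨(l1 + 1, l2), ⟨by simp [W2]; omega, Or.inl ?_⟩⟩
    simp_all
  by_cases h' : m1 = l1 + 1 ∧ n1 = l1 + 1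
  · refine ⟨(l1 + 1, l2 + 1), ⟨by simp [W2]; omega, ?_⟩⟩
    simp [h]
    omega
  · refine ⟨(m1, m2) + (n1, n2) - (l1, l2), ⟨by simp [W2]; omega, ?_⟩⟩
    rcases hlm with hlm | hlm | hlm <;> rcases hln with hln | hln | hln <;>
      obtain ⟨rfl, rfl⟩ := hlm <;> obtain ⟨rfl, rfl⟩ := hln <;>
      simp_all [UpStep, add_comm (1 : ℤ), Prod.ext_iff]

theorem exists_bottom_left (hm : m ∈ W2) (hn : n ∈ W2) (ho : o ∈ W2) (hmo : UpStep (o - m))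
    (hno : UpStep (o - n)) : ∃ l, ∃ x : Prop, GrowthCell l m n x o := by
  obtain ⟨m1, m2⟩ := m
  obtain ⟨n1, n2⟩ := n
  obtain ⟨o1, o2⟩ := o
  simp only [UpStep, W2, Set.mem_ofPred_eq, Prod.mk_sub_mk, Prod.mk.injEq] at *
  by_cases h : o1 = m1 + 1 ∧ o1 = n1 + 1
  · refine ⟨(m1, m2), True, ⟨by simp [W2]; omega, ?_⟩⟩
    simp
    omega
  by_cases h' : o2 = m2 + 1 ∧ o2 = n2 + 1
  · refine ⟨(m1 - 1, m2), False, ⟨by simp [W2]; omega, ?_⟩⟩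
    simp
    omega
  · refine ⟨(m1, m2) + (n1, n2) - (o1, o2), False, ⟨by simp [W2]; omega, ?_⟩⟩
    rcases hmo with hmo | hmo | hmo <;> rcases hno with hno | hno | hno <;>
      obtain ⟨hmo1, hmo2⟩ := hmo <;> obtain ⟨hno1, hno2⟩ := hno <;>
      obtain ⟨rfl, rfl⟩ : o1 = _ ∧ o2 = _ := ⟨sub_eq_iff_eq_add.1 hmo1, sub_eq_iff_eq_add.1 hmo2⟩ <;>
      obtain ⟨rfl, rfl⟩ : n1 = _ ∧ n2 = _ := ⟨eq_sub_of_add_eq' (sub_eq_iff_eq_add.1 hno1).symm,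
        eq_sub_of_add_eq' (sub_eq_iff_eq_add.1 hno2).symm⟩ <;>
      simp_all [UpStep, add_comm (1 : ℤ), Prod.ext_iff]

end GrowthCell

/-- `L` is a growth diagram with filling `X` on the staircase of cells `(p, r)` with `p + r < s`. -/
structure IsGrowth (s : ℕ) (X : ℕ → ℕ → Prop) (L : ℕ → ℕ → ℤ × ℤ) : Prop where
  left : ∀ r ≤ s + 1, L 0 r = (1, 0)
  bottom : ∀ p ≤ s + 1, L p 0 = (1, 0)
  cell : ∀ p r, p + r < s → GrowthCell (L p r) (L (p + 1) r) (L p (r + 1)) (X p r)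
    (L (p + 1) (r + 1))

/-- Every row and every column contains at most one filled cell. -/
def IsPartialPerm (s : ℕ) (X : ℕ → ℕ → Prop) : Prop :=
  (∀ p r r', p + r < s → p + r' < s → X p r → X p r' → r = r') ∧
    ∀ p p' r, p + r < s → p' + r < s → X p r → X p' r → p = p'

/-- Three filled cells running from top left to bottom right, in a rectangle inside the
staircase. -/
def HasDescent (s : ℕ) (X : ℕ → ℕ → Prop) : Prop :=
  ∃ p₁ p₂ p₃ r₁ r₂ r₃, p₁ < p₂ ∧ p₂ < p₃ ∧ r₂ < r₁ ∧ r₃ < r₂ ∧ p₃ + r₁ < s ∧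
    X p₁ r₁ ∧ X p₂ r₂ ∧ X p₃ r₃

namespace IsGrowth

variable {s : ℕ} {X X' : ℕ → ℕ → Prop} {L L' : ℕ → ℕ → ℤ × ℤ} {p r : ℕ}

theorem flip (h : IsGrowth s X L) : IsGrowth s (fun p r => X r p) (fun p r => L r p) :=
  ⟨h.bottom, h.left, fun p r hpr => (h.cell r p (by omega)).flip⟩

theorem mem_W2 (h : IsGrowth s X L) (hpr : p + r ≤ s + 1) : L p r ∈ W2 := by
  rcases p with - | p
  · rw [h.left r (by omega)]
    simp [W2]
  rcases r with - | r
  · rw [h.bottom (p + 1) (by omega)]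
    simp [W2]
  · exact (h.cell p r (by omega)).1.2.2.2

theorem upStep_right (h : IsGrowth s X L) (hpr : p + r ≤ s) : UpStep (L (p + 1) r - L p r) := by
  rcases r with - | r
  · rw [h.bottom (p + 1) (by omega), h.bottom p (by omega)]
    simp [UpStep, Prod.ext_iff]
  · exact (h.cell p r (by omega)).upStep_top

theorem upStep_up (h : IsGrowth s X L) (hpr : p + r ≤ s) : UpStep (L p (r + 1) - L p r) :=
  h.flip.upStep_right (p := r) (r := p) (by omega)

theorem exists_filled_of_fst (h : IsGrowth s X L) (hpr : p + r ≤ s)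
    (hL : L (p + 1) r = L p r + (1, 0)) :
    ∃ t < r, X p t ∧ ∀ y, t < y → y ≤ r → L (p + 1) y = L p y + (1, 0) := by
  induction r with
  | zero => simp [h.bottom (p + 1) (by omega), h.bottom p (by omega)] at hL
  | succ r ih =>
    rcases (h.cell p r (by omega)).top_eq_fst_iff.1 hL with hx | ⟨hm, -⟩
    · refine ⟨r, by omega, hx, fun y hy hy' => ?_⟩
      obtain rfl : y = r + 1 := by omega
      exact hL
    · obtain ⟨t, htr, hx, ht⟩ := ih (by omega) hm
      refine ⟨t, by omega, hx, fun y hy hy' => ?_⟩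
      rcases eq_or_lt_of_le hy' with rfl | hy'
      · exact hL
      · exact ht y hy (by omega)

theorem exists_turn_of_snd (h : IsGrowth s X L) (hpr : p + r ≤ s)
    (hL : L (p + 1) r = L p r + (0, 1)) :
    ∃ t < r, L (p + 1) t = L p t + (1, 0) ∧ L p (t + 1) = L p t + (1, 0) := by
  induction r with
  | zero => simp [h.bottom (p + 1) (by omega), h.bottom p (by omega)] at hL
  | succ r ih =>
    rcases (h.cell p r (by omega)).top_eq_snd_iff.1 hL with hm | hm
    · obtain ⟨t, htr, ht⟩ := ih (by omega) hm
      exact ⟨t, by omega, ht⟩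
    · exact ⟨r, by omega, hm⟩

theorem snd_persists (h : IsGrowth s X L) {r' : ℕ} (hr : r ≤ r') (hpr : p + r' ≤ s)
    (hL : L (p + 1) r = L p r + (0, 1)) : L (p + 1) r' = L p r' + (0, 1) := by
  induction r', hr using Nat.le_induction with
  | base => exact hL
  | succ r' hr ih => exact (h.cell p r' (by omega)).top_eq_snd_iff.2 (Or.inl (ih (by omega)))

theorem ne_persists (h : IsGrowth s X L) {r' : ℕ} (hr : r ≤ r') (hpr : p + r' ≤ s)
    (hL : L (p + 1) r ≠ L p r) : L (p + 1) r' ≠ L p r' := by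
  induction r', hr using Nat.le_induction with
  | base => exact hL
  | succ r' hr ih =>
    exact fun e => ih (by omega) ((h.cell p r' (by omega)).bottom_eq_of_top_eq e)

theorem fst_persists_or_turn (h : IsGrowth s X L) {r' : ℕ} (hr : r ≤ r') (hpr : p + r' ≤ s)
    (hL : L (p + 1) r = L p r + (1, 0)) :
    L (p + 1) r' = L p r' + (1, 0) ∨
      ∃ t, r ≤ t ∧ t < r' ∧ L (p + 1) t = L p t + (1, 0) ∧ L p (t + 1) = L p t + (1, 0) := by
  induction r', hr using Nat.le_induction with
  | base => exact Or.inl hL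
  | succ r' hr ih =>
    rcases ih (by omega) with ih | ⟨t, ht, ht', htt⟩
    · by_cases hn : L p (r' + 1) = L p r' + (1, 0)
      · exact Or.inr ⟨r', hr, by omega, ih, hn⟩
      · exact Or.inl ((h.cell p r' (by omega)).top_eq_fst_iff.2 (Or.inr ⟨ih, hn⟩))
    · exact Or.inr ⟨t, ht, by omega, htt⟩

theorem exists_turn_of_two_filled (h : IsGrowth s X L) {p₁ p₂ r₁ r₂ : ℕ} (hp : p₁ < p₂)
    (hr : r₂ < r₁) (hs : p₂ + r₁ < s) (h₁ : X p₁ r₁) (h₂ : X p₂ r₂) :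
    ∃ p r, p₁ < p ∧ p ≤ p₂ ∧ r₂ < r ∧ r ≤ r₁ ∧
      L (p + 1) r = L p r + (1, 0) ∧ L p (r + 1) = L p r + (1, 0) := by
  have hcol := (h.cell p₂ r₂ (by omega)).top_eq_of_filled h₂
  have hrow := (h.flip.cell r₁ p₁ (by omega)).top_eq_of_filled h₁
  rcases h.fst_persists_or_turn (r' := r₁) hr (by omega) hcol with hcol | ⟨t, ht, ht', htt⟩
  · rcases h.flip.fst_persists_or_turn (r' := p₂) hp (by omega) hrow with hrow | ⟨t, ht, ht', htt⟩
    · exact ⟨p₂, r₁, hp, le_rfl, hr, le_rfl, hcol, hrow⟩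
    · exact ⟨t, r₁, ht, ht'.le, hr, le_rfl, htt.2, htt.1⟩
  · exact ⟨p₂, t, hp, le_rfl, ht, ht'.le, htt⟩

theorem not_hasDescent (h : IsGrowth s X L) : ¬ HasDescent s X := by
  rintro ⟨p₁, p₂, p₃, r₁, r₂, r₃, hp₁, hp₂, hr₁, hr₂, hs, h₁, h₂, h₃⟩
  obtain ⟨a, b, ha, ha', hb, hb', hab, hab'⟩ :=
    h.exists_turn_of_two_filled hp₁ hr₁ (by omega) h₁ h₂
  obtain ⟨c, d, hc, hc', hd, hd', hcd, hcd'⟩ :=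
    h.exists_turn_of_two_filled hp₂ hr₂ (by omega) h₂ h₃
  have hcol := (h.cell c d (by omega)).top_eq_snd_iff.2 (Or.inr ⟨hcd, hcd'⟩)
  have hrow := (h.flip.cell b a (by omega)).top_eq_snd_iff.2 (Or.inr ⟨hab', hab⟩)
  exact (h.cell c b (by omega)).not_both_snd
    (h.snd_persists (r' := b) (by omega) (by omega) hcol)
    (h.flip.snd_persists (r' := c) (by omega) (by omega) hrow)

theorem column_injective (h : IsGrowth s X L) {r' : ℕ} (hpr : p + r' < s) (hx : X p r)
    (hx' : X p r') (hr : r < r') : False := by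
  have := (h.cell p r (by omega)).top_eq_of_filled hx
  exact h.ne_persists (r' := r') hr (by omega) (by rw [this]; simp)
    ((h.cell p r' hpr).bottom_eq_of_filled hx')

theorem isPartialPerm (h : IsGrowth s X L) : IsPartialPerm s X := by
  refine ⟨fun p r r' hs hs' hx hx' => ?_, fun p p' r hs hs' hx hx' => ?_⟩
  · rcases lt_trichotomy r r' with hr | hr | hr
    · exact (h.column_injective hs' hx hx' hr).elim
    · exact hr
    · exact (h.column_injective hs hx' hx hr).elim
  · rcases lt_trichotomy p p' with hp | hp | hp
    · exact (h.flip.column_injective (by omega) hx hx' hp).elim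
    · exact hp
    · exact (h.flip.column_injective (by omega) hx' hx hp).elim

theorem unique (h : IsGrowth s X L) (h' : IsGrowth s X' L')
    (hX : ∀ p r, p + r < s → (X p r ↔ X' p r)) (hpr : p + r ≤ s + 1) : L p r = L' p r := by
  induction p generalizing r with
  | zero => rw [h.left r (by omega), h'.left r (by omega)]
  | succ p ihp =>
    induction r with
    | zero => rw [h.bottom _ (by omega), h'.bottom _ (by omega)]
    | succ r ihr =>
      have c := h.cell p r (by omega)
      have c' := h'.cell p r (by omega)
      rw [← ihp (by omega), ← ihp (by omega), ← ihr (by omega)] at c'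
      exact c.top_right_unique c' (hX p r (by omega))

theorem filling_unique (h : IsGrowth s X L) (h' : IsGrowth s X' L')
    (hL : ∀ p r, s ≤ p + r → p + r ≤ s + 1 → L p r = L' p r) (hpr : p + r < s) :
    X p r ↔ X' p r := by
  have key : ∀ d p r, s ≤ p + r + d → p + r ≤ s + 1 → L p r = L' p r := by
    intro d
    induction d with
    | zero => exact fun p r h₁ h₂ => hL p r h₁ h₂
    | succ d ih =>
      intro p r h₁ h₂
      rcases lt_or_ge (p + r) s with hlt | hge
      · have c := h.cell p r hlt
        have c' := h'.cell p r hlt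
        rw [← ih (p + 1) r (by omega) (by omega), ← ih p (r + 1) (by omega) (by omega),
          ← ih (p + 1) (r + 1) (by omega) (by omega)] at c'
        exact (c.bottom_left_unique c').1
      · exact hL p r hge h₂
  have c := h.cell p r hpr
  have c' := h'.cell p r hpr
  rw [← key s (p + 1) r (by omega) (by omega), ← key s p (r + 1) (by omega) (by omega),
    ← key s (p + 1) (r + 1) (by omega) (by omega)] at c'
  exact (c.bottom_left_unique c').2

theorem exists_cell (h : IsGrowth s X L) (hpr : p + r = s) (hX : IsPartialPerm (s + 1) X)
    (hd : ¬ HasDescent (s + 1) X) :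
    ∃ o, GrowthCell (L p r) (L (p + 1) r) (L p (r + 1)) (X p r) o := by
  refine GrowthCell.exists_top_right (h.mem_W2 (by omega)) (h.mem_W2 (by omega))
    (h.mem_W2 (by omega)) (h.upStep_right hpr.le) (h.upStep_up hpr.le) (fun hx => ?_) ?_
  · have column : ∀ {X L} {p r : ℕ}, IsGrowth s X L → p + r = s → IsPartialPerm (s + 1) X → X p r →
        L (p + 1) r = L p r := by
      intro X L p r h hpr hX hx
      have fst_ne : ∀ q ≤ r, L (p + 1) q ≠ L p q + (1, 0) := by
        intro q hq hL
        obtain ⟨t, ht, hxt, -⟩ := h.exists_filled_of_fst (by omega) hL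
        have := hX.1 p t r (by omega) (by omega) hxt hx
        omega
      rcases h.upStep_right hpr.le with hL | hL | hL
      · exact (fst_ne r le_rfl (sub_eq_iff_eq_add'.1 hL)).elim
      · obtain ⟨t, ht, hL, -⟩ := h.exists_turn_of_snd hpr.le (sub_eq_iff_eq_add'.1 hL)
        exact (fst_ne t ht.le hL).elim
      · exact sub_eq_zero.1 hL
    refine ⟨column h hpr hX hx, column h.flip (by omega) ⟨fun a b c h₁ h₂ => ?_,
      fun a b c h₁ h₂ => ?_⟩ hx⟩
    · exact hX.2 b c a (by omega) (by omega)
    · exact hX.1 c a b (by omega) (by omega)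
  · rintro ⟨hm, hn⟩
    obtain ⟨r₀, hr₀, hb, hl⟩ := h.exists_turn_of_snd hpr.le hm
    obtain ⟨p₀, hp₀, hl', hb'⟩ := h.flip.exists_turn_of_snd (by omega) hn
    obtain ⟨t₂, ht₂, hx₂, -⟩ := h.exists_filled_of_fst (by omega) hb
    obtain ⟨s₂, hs₂, hy₂, hrow⟩ := h.flip.exists_filled_of_fst (by omega) hl
    obtain ⟨t₁, ht₁, hx₁, hcol⟩ := h.exists_filled_of_fst (by omega) hb'
    obtain ⟨s₁, hs₁, hy₁, -⟩ := h.flip.exists_filled_of_fst (by omega) hl'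
    by_cases hss : s₁ < s₂
    · exact hd ⟨s₁, s₂, p, r, r₀, t₂, hss, hs₂, hr₀, ht₂, by omega, hy₁, hy₂, hx₂⟩
    by_cases htt : t₂ < t₁
    · exact hd ⟨s₁, p₀, p, r, t₁, t₂, hs₁, hp₀, ht₁, htt, by omega, hy₁, hx₁, hx₂⟩
    have h₁ := hcol r₀ (by omega) hr₀.le
    have h₂ := hrow p₀ (by omega) hp₀.le
    have h₃ := (h.cell p₀ r₀ (by omega)).top_eq_snd_iff.2 (Or.inr ⟨h₁, h₂⟩)
    have h₄ := hcol (r₀ + 1) (by omega) hr₀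
    rw [h₃] at h₄
    simp at h₄

end IsGrowth

/-- The growth diagram of a filling, computed by the local rule from the axes. -/
noncomputable def growthDiagram (X : ℕ → ℕ → Prop) : ℕ → ℕ → ℤ × ℤ
  | 0, _ => (1, 0)
  | _ + 1, 0 => (1, 0)
  | p + 1, r + 1 => Classical.epsilon fun o => GrowthCell (growthDiagram X p r)
      (growthDiagram X (p + 1) r) (growthDiagram X p (r + 1)) (X p r) o
  termination_by p r => (p, r)

theorem isGrowth_growthDiagram {N : ℕ} {X : ℕ → ℕ → Prop} (hX : IsPartialPerm N X)
    (hd : ¬ HasDescent N X) : IsGrowth N X (growthDiagram X) := by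
  have left : ∀ r, growthDiagram X 0 r = (1, 0) := fun r => by rw [growthDiagram]
  have bottom : ∀ p, growthDiagram X p 0 = (1, 0) := by
    rintro (- | p) <;> rw [growthDiagram]
  suffices ∀ s ≤ N, IsGrowth s X (growthDiagram X) from this N le_rfl
  intro s
  induction s with
  | zero => exact fun _ => ⟨fun r _ => left r, fun p _ => bottom p, fun p r h => by omega⟩
  | succ s ih =>
    intro hs
    have h := ih (by omega)
    refine ⟨fun r _ => left r, fun p _ => bottom p, fun p r hpr => ?_⟩
    rcases Nat.lt_succ_iff_lt_or_eq.1 hpr with hlt | heq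
    · exact h.cell p r hlt
    · rw [growthDiagram.eq_3]
      refine Classical.epsilon_spec (h.exists_cell heq ⟨fun a b c h₁ h₂ => ?_,
        fun a b c h₁ h₂ => ?_⟩ ?_)
      · exact hX.1 a b c (by omega) (by omega)
      · exact hX.2 a b c (by omega) (by omega)
      · rintro ⟨p₁, p₂, p₃, r₁, r₂, r₃, hp₁, hp₂, hr₁, hr₂, hsum, hx⟩
        exact hd ⟨p₁, p₂, p₃, r₁, r₂, r₃, hp₁, hp₂, hr₁, hr₂, by omega, hx⟩

/-- The walk read along the boundary of the staircase of size `N`. -/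
def boundaryWalk (N : ℕ) (L : ℕ → ℕ → ℤ × ℤ) (m : ℕ) : ℤ × ℤ :=
  L ((min m (2 * N) + 1) / 2) (N - min m (2 * N) / 2)

theorem boundaryWalk_even {N : ℕ} (L : ℕ → ℕ → ℤ × ℤ) {k : ℕ} (hk : k ≤ N) :
    boundaryWalk N L (2 * k) = L k (N - k) := by
  unfold boundaryWalk
  congr <;> omega

theorem boundaryWalk_odd {N : ℕ} (L : ℕ → ℕ → ℤ × ℤ) {k : ℕ} (hk : k < N) :
    boundaryWalk N L (2 * k + 1) = L (k + 1) (N - k) := by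
  unfold boundaryWalk
  congr <;> omega

theorem boundaryWalk_of_le {N : ℕ} (L : ℕ → ℕ → ℤ × ℤ) {m : ℕ} (hm : 2 * N ≤ m) :
    boundaryWalk N L m = boundaryWalk N L (2 * N) := by
  unfold boundaryWalk
  congr 3 <;> omega

theorem UpStep.downStep {d e : ℤ × ℤ} (h : UpStep (d - e)) : DownStep (e - d) := by
  simp only [UpStep, DownStep, Prod.ext_iff, Prod.fst_sub, Prod.snd_sub] at *
  omega

theorem DownStep.upStep {d e : ℤ × ℤ} (h : DownStep (d - e)) : UpStep (e - d) := by
  simp only [UpStep, DownStep, Prod.ext_iff, Prod.fst_sub, Prod.snd_sub] at *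
  omega

theorem upStep_self (d : ℤ × ℤ) : UpStep (d - d) := by
  simp [UpStep, Prod.ext_iff]

theorem eq_origin_of_upStep {d : ℤ × ℤ} (hd : d ∈ W2) (h : UpStep ((1, 0) - d)) : d = (1, 0) := by
  simp only [UpStep, W2, Prod.ext_iff, Prod.fst_sub, Prod.snd_sub, Set.mem_ofPred_eq] at *
  omega

theorem IsGrowth.isBWalk_boundaryWalk {N : ℕ} {X : ℕ → ℕ → Prop} {L : ℕ → ℕ → ℤ × ℤ}
    (h : IsGrowth N X L) : IsBWalk W2 (2 * N) (boundaryWalk N L) := by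
  refine ⟨?_, fun r hr => h.mem_W2 (by omega), fun r hr₁ hr hodd => ?_, fun r hr₁ hr heven => ?_,
    fun r hr => boundaryWalk_of_le L hr⟩
  · rw [← Nat.mul_zero 2, boundaryWalk_even L N.zero_le, h.left _ (by omega)]
  · obtain ⟨k, rfl⟩ : ∃ k, r = 2 * k + 1 := ⟨r / 2, by omega⟩
    rw [Nat.add_sub_cancel, boundaryWalk_odd L (by omega), boundaryWalk_even L (by omega)]
    exact h.upStep_right (by omega)
  · obtain ⟨k, rfl⟩ : ∃ k, r = 2 * (k + 1) := ⟨r / 2 - 1, by omega⟩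
    rw [show 2 * (k + 1) - 1 = 2 * k + 1 by omega, boundaryWalk_odd L (by omega),
      boundaryWalk_even L (by omega), show N - k = N - (k + 1) + 1 by omega]
    exact (h.upStep_up (by omega)).downStep

theorem IsGrowth.boundaryWalk_end {N : ℕ} {X : ℕ → ℕ → Prop} {L : ℕ → ℕ → ℤ × ℤ}
    (h : IsGrowth N X L) : boundaryWalk N L (2 * N) = (1, 0) := by
  rw [boundaryWalk_even L le_rfl, Nat.sub_self, h.bottom _ (by omega)]

theorem IsGrowth.eq_of_boundaryWalk_eq {N : ℕ} {X X' : ℕ → ℕ → Prop} {L L' : ℕ → ℕ → ℤ × ℤ}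
    (h : IsGrowth N X L) (h' : IsGrowth N X' L') (hL : boundaryWalk N L = boundaryWalk N L')
    {p r : ℕ} (hpr : p + r < N) : X p r ↔ X' p r := by
  refine h.filling_unique h' (fun p r h₁ h₂ => ?_) hpr
  rcases p with - | p
  · rw [h.left r (by omega), h'.left r (by omega)]
  rcases r with - | r
  · rw [h.bottom _ (by omega), h'.bottom _ (by omega)]
  rcases eq_or_lt_of_le h₁ with heq | hlt
  · have := congrFun hL (2 * (p + 1))
    rwa [boundaryWalk_even _ (by omega), boundaryWalk_even _ (by omega),
      show N - (p + 1) = r + 1 by omega] at this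
  · have := congrFun hL (2 * p + 1)
    rwa [boundaryWalk_odd _ (by omega), boundaryWalk_odd _ (by omega),
      show N - p = r + 1 by omega] at this

/-- The shapes of the growth diagram with boundary walk `w`, computed by the reverse local rule.
The first argument is the distance to the outermost antidiagonal, the second one the column. -/
noncomputable def reverseGrowth (w : ℕ → ℤ × ℤ) : ℕ → ℕ → ℤ × ℤ
  | 0, p => w (2 * p - 1)
  | 1, p => w (2 * p)
  | d + 2, p => Classical.epsilon fun l => ∃ x : Prop, GrowthCell l (reverseGrowth w (d + 1) (p + 1))
      (reverseGrowth w (d + 1) p) x (reverseGrowth w d (p + 1))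

section Reverse

variable {N : ℕ} {w : ℕ → ℤ × ℤ}

theorem reverseGrowth_step (hw : IsBWalk W2 (2 * N) w) (d : ℕ) :
    (∀ p, p + d ≤ N + 1 → reverseGrowth w d p ∈ W2) ∧
      ∀ p, p + d ≤ N → reverseGrowth w (d + 1) p ∈ W2 ∧
        UpStep (reverseGrowth w d (p + 1) - reverseGrowth w (d + 1) p) ∧
        UpStep (reverseGrowth w d p - reverseGrowth w (d + 1) p) := by
  obtain ⟨-, hW, hup, hdown, hconst⟩ := hw
  induction d with
  | zero =>
    simp only [reverseGrowth]
    refine ⟨fun p hp => ?_, fun p hp => ⟨hW _ (by omega), ?_, ?_⟩⟩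
    · rcases le_or_gt (2 * p - 1) (2 * N) with hle | hlt
      · exact hW _ hle
      · rw [hconst _ hlt.le]
        exact hW _ le_rfl
    · rcases eq_or_lt_of_le hp with rfl | hlt
      · rw [show 2 * (p + 0) = 2 * p by omega] at hconst
        rw [hconst (2 * (p + 1) - 1) (by omega)]
        exact upStep_self _
      · exact hup (2 * (p + 1) - 1) (by omega) (by omega) (by omega)
    · rcases p with - | p
      · exact upStep_self _
      · exact (hdown (2 * (p + 1)) (by omega) (by omega) (by omega)).upStep
  | succ d ih =>
    refine ⟨fun p hp => (ih.2 p (by omega)).1, fun p hp => ?_⟩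
    have hl := ih.2 p (by omega)
    have hr := ih.2 (p + 1) (by omega)
    obtain ⟨x, hx⟩ := Classical.epsilon_spec
      (GrowthCell.exists_bottom_left hr.1 hl.1 (ih.1 (p + 1) (by omega)) hr.2.2 hl.2.1)
    rw [reverseGrowth]
    exact ⟨hx.1.1, hx.upStep_bottom, hx.flip.upStep_bottom⟩

theorem reverseGrowth_cell (hw : IsBWalk W2 (2 * N) w) {d p : ℕ} (hdp : p + d + 1 ≤ N) :
    ∃ x : Prop, GrowthCell (reverseGrowth w (d + 2) p) (reverseGrowth w (d + 1) (p + 1))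
      (reverseGrowth w (d + 1) p) x (reverseGrowth w d (p + 1)) := by
  have hl := (reverseGrowth_step hw d).2 p (by omega)
  have hr := (reverseGrowth_step hw d).2 (p + 1) (by omega)
  rw [reverseGrowth]
  exact Classical.epsilon_spec (GrowthCell.exists_bottom_left hr.1 hl.1
    ((reverseGrowth_step hw d).1 (p + 1) (by omega)) hr.2.2 hl.2.1)

theorem reverseGrowth_left (hw : IsBWalk W2 (2 * N) w) {d : ℕ} (hd : d ≤ N + 1) :
    reverseGrowth w d 0 = (1, 0) := by
  induction d with
  | zero => exact hw.1
  | succ d ih =>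
    have h := (reverseGrowth_step hw d).2 0 (by omega)
    rw [ih (by omega)] at h
    exact eq_origin_of_upStep h.1 h.2.2

theorem reverseGrowth_bottom (hw : IsBWalk W2 (2 * N) w) (hend : w (2 * N) = (1, 0)) {d p : ℕ}
    (hd : p + d = N + 1) : reverseGrowth w d p = (1, 0) := by
  induction d generalizing p with
  | zero =>
    rw [reverseGrowth, hw.2.2.2.2 _ (by omega), hend]
  | succ d ih =>
    have h := (reverseGrowth_step hw d).2 p (by omega)
    rw [ih (by omega : p + 1 + d = N + 1)] at h
    exact eq_origin_of_upStep h.1 h.2.1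

theorem exists_isGrowth_boundaryWalk_eq (hw : IsBWalk W2 (2 * N) w) (hend : w (2 * N) = (1, 0)) :
    ∃ X L, IsGrowth N X L ∧ boundaryWalk N L = w := by
  have hcell : ∀ p r, ∃ x : Prop, p + r < N → GrowthCell (reverseGrowth w (N + 1 - p - r) p)
      (reverseGrowth w (N + 1 - (p + 1) - r) (p + 1)) (reverseGrowth w (N + 1 - p - (r + 1)) p) x
      (reverseGrowth w (N + 1 - (p + 1) - (r + 1)) (p + 1)) := by
    intro p r
    by_cases hpr : p + r < N
    · obtain ⟨d, rfl⟩ := Nat.exists_eq_add_of_lt hpr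
      obtain ⟨x, hx⟩ := reverseGrowth_cell hw (d := d) (p := p) (by omega)
      refine ⟨x, fun _ => ?_⟩
      convert hx using 2 <;> omega
    · exact ⟨True, fun h => (hpr h).elim⟩
  choose X hX using hcell
  refine ⟨X, fun p r => reverseGrowth w (N + 1 - p - r) p,
    ⟨fun r hr => reverseGrowth_left hw (by omega),
      fun p hp => reverseGrowth_bottom hw hend (by omega), hX⟩, ?_⟩
  have hle : ∀ m ≤ 2 * N, boundaryWalk N (fun p r => reverseGrowth w (N + 1 - p - r) p) m = w m := by
    intro m hm
    rcases Nat.even_or_odd' m with ⟨k, rfl | rfl⟩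
    · rw [boundaryWalk_even _ (by omega), show N + 1 - k - (N - k) = 1 by omega, reverseGrowth]
    · rw [boundaryWalk_odd _ (by omega), show N + 1 - (k + 1) - (N - k) = 0 by omega, reverseGrowth]
      congr 1
  funext m
  rcases le_total m (2 * N) with hm | hm
  · exact hle m hm
  · rw [boundaryWalk_of_le _ hm, hle _ le_rfl, hw.2.2.2.2 m hm]

end Reverse

/-- The filling of the staircase attached to a set of arcs: the arc `(i, j)` fills the cell in
column `i` and row `N - 1 - j`. -/
def arcFilling {N : ℕ} (B : Finset (Fin N × Fin N)) (p r : ℕ) : Prop :=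
  ∃ a ∈ B, (a.1 : ℕ) = p ∧ (a.2 : ℕ) + r + 1 = N

theorem mem_iff_arcFilling {N : ℕ} {B : Finset (Fin N × Fin N)} (a : Fin N × Fin N) :
    a ∈ B ↔ arcFilling B a.1 (N - 1 - a.2) := by
  refine ⟨fun ha => ⟨a, ha, rfl, by omega⟩, ?_⟩
  rintro ⟨b, hb, h₁, h₂⟩
  obtain rfl : b = a := Prod.ext (Fin.ext h₁) (Fin.ext (by omega))
  exact hb

theorem isPartialPerm_arcFilling {N : ℕ} {B : Finset (Fin N × Fin N)} (hB : IsBraid B) :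
    IsPartialPerm N (arcFilling B) := by
  refine ⟨?_, ?_⟩
  · rintro p r r' - - ⟨a, ha, h₁, h₂⟩ ⟨b, hb, h₁', h₂'⟩
    obtain rfl := hB.2.1 a ha b hb (Fin.ext (by omega))
    omega
  · rintro p p' r - - ⟨a, ha, h₁, h₂⟩ ⟨b, hb, h₁', h₂'⟩
    obtain rfl := hB.2.2 a ha b hb (Fin.ext (by omega))
    omega

theorem hasDescent_arcFilling_iff {N : ℕ} {B : Finset (Fin N × Fin N)} :
    HasDescent N (arcFilling B) ↔ BraidHasKCrossing 3 B := by
  constructor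
  · rintro ⟨p₁, p₂, p₃, r₁, r₂, r₃, hp₁, hp₂, hr₁, hr₂, hs, ⟨a, ha, h₁, h₁'⟩, ⟨b, hb, h₂, h₂'⟩,
      ⟨c, hc, h₃, h₃'⟩⟩
    refine ⟨![a.1, b.1, c.1], ![a.2, b.2, c.2], ?_, ?_, ?_, ?_⟩
    · rw [Fin.strictMono_iff_lt_succ]
      intro i
      fin_cases i <;> simp <;> omega
    · rw [Fin.strictMono_iff_lt_succ]
      intro i
      fin_cases i <;> simp <;> omega
    · intro i
      fin_cases i <;> simpa
    · intro i j
      fin_cases i <;> fin_cases j <;> simp <;> omega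
  · rintro ⟨a, b, ha, hb, hB, hab⟩
    have h₁ := hb (show (0 : Fin 3) < 1 by decide)
    have h₂ := hb (show (1 : Fin 3) < 2 by decide)
    have h₃ := hab 2 0
    rw [Fin.lt_def] at h₁ h₂
    rw [Fin.le_def] at h₃
    refine ⟨a 0, a 1, a 2, N - 1 - b 0, N - 1 - b 1, N - 1 - b 2, ha (by decide), ha (by decide),
      by omega, by omega, by omega, ?_⟩
    exact ⟨(mem_iff_arcFilling _).1 (hB 0), (mem_iff_arcFilling _).1 (hB 1),
      (mem_iff_arcFilling _).1 (hB 2)⟩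

theorem isGrowth_of_isKNoncrossingBraid {N : ℕ} {B : Finset (Fin N × Fin N)}
    (hB : IsKNoncrossingBraid 3 B) : IsGrowth N (arcFilling B) (growthDiagram (arcFilling B)) :=
  isGrowth_growthDiagram (isPartialPerm_arcFilling hB.1) (mt hasDescent_arcFilling_iff.1 hB.2)

theorem exists_arcFilling {N : ℕ} {X : ℕ → ℕ → Prop} (hX : IsPartialPerm N X)
    (hd : ¬ HasDescent N X) :
    ∃ B : Finset (Fin N × Fin N), IsKNoncrossingBraid 3 B ∧
      ∀ p r, p + r < N → (arcFilling B p r ↔ X p r) := by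
  classical
  let B : Finset (Fin N × Fin N) :=
    Finset.univ.filter fun a => a.1 ≤ a.2 ∧ X a.1 (N - 1 - a.2)
  have hmem : ∀ a, a ∈ B ↔ a.1 ≤ a.2 ∧ X a.1 (N - 1 - a.2) := fun a => by simp [B]
  have hfill : ∀ p r, p + r < N → (arcFilling B p r ↔ X p r) := by
    intro p r hpr
    have := mem_iff_arcFilling (B := B) (⟨p, by omega⟩, ⟨N - 1 - r, by omega⟩)
    rw [hmem, Fin.le_def] at this
    simp only [show N - 1 - (N - 1 - r) = r by omega] at this
    rw [← this]
    exact and_iff_right (by omega)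
  have hfill' : ∀ p r, arcFilling B p r → X p r := by
    rintro p r ⟨a, ha, h₁, h₂⟩
    have := (hmem a).1 ha
    rw [h₁, show N - 1 - (a.2 : ℕ) = r by omega] at this
    exact this.2
  refine ⟨B, ⟨⟨fun a ha => ((hmem a).1 ha).1, fun a ha b hb hab => ?_, fun a ha b hb hab => ?_⟩,
    fun hc => hd ?_⟩, hfill⟩
  · obtain ⟨h₁, hx₁⟩ := (hmem a).1 ha
    obtain ⟨h₂, hx₂⟩ := (hmem b).1 hb
    rw [Fin.le_def] at h₁ h₂
    rw [← hab] at hx₂ h₂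
    have := hX.1 _ _ _ (by omega) (by omega) hx₁ hx₂
    exact Prod.ext hab (Fin.ext (by omega))
  · obtain ⟨h₁, hx₁⟩ := (hmem a).1 ha
    obtain ⟨h₂, hx₂⟩ := (hmem b).1 hb
    rw [Fin.le_def] at h₁ h₂
    rw [← hab] at hx₂ h₂
    exact Prod.ext (Fin.ext (hX.2 _ _ _ (by omega) (by omega) hx₁ hx₂)) hab
  · obtain ⟨p₁, p₂, p₃, r₁, r₂, r₃, hp₁, hp₂, hr₁, hr₂, hs, h₁, h₂, h₃⟩ :=
      hasDescent_arcFilling_iff.2 hc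
    exact ⟨p₁, p₂, p₃, r₁, r₂, r₃, hp₁, hp₂, hr₁, hr₂, hs, hfill' _ _ h₁, hfill' _ _ h₂,
      hfill' _ _ h₃⟩

/-- For every `N ≥ 1`, the number of 3-noncrossing braids over `[N]`
equals `σ^{1,0}_{2N}`, the number of `ℬ_{W₂}`-walks of length `2N` ending at `(1,0)`. -/
theorem number_of_three_noncrossing_braids (N : ℕ) (hN : 1 ≤ N) :
    Nat.card {B : Finset (Fin N × Fin N) // IsKNoncrossingBraid 3 B}
      = sigmaB (2 * N) (1, 0) := by
  let f : {B : Finset (Fin N × Fin N) // IsKNoncrossingBraid 3 B} →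
      {w : ℕ → ℤ × ℤ // IsBWalk W2 (2 * N) w ∧ w (2 * N) = (1, 0)} := fun B =>
    ⟨boundaryWalk N (growthDiagram (arcFilling B.1)),
      (isGrowth_of_isKNoncrossingBraid B.2).isBWalk_boundaryWalk,
      (isGrowth_of_isKNoncrossingBraid B.2).boundaryWalk_end⟩
  refine Nat.card_congr (Equiv.ofBijective f ⟨?_, ?_⟩)
  · rintro ⟨B, hB⟩ ⟨B', hB'⟩ h
    refine Subtype.ext (Finset.ext fun a => ?_)
    have key := (isGrowth_of_isKNoncrossingBraid hB).eq_of_boundaryWalk_eq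
      (isGrowth_of_isKNoncrossingBraid hB') (congrArg Subtype.val h)
      (p := a.1) (r := N - 1 - a.2)
    by_cases ha : a.1 ≤ a.2
    · rw [mem_iff_arcFilling, mem_iff_arcFilling]
      rw [Fin.le_def] at ha
      exact key (by omega)
    · exact iff_of_false (fun h => ha (hB.1.1 a h)) fun h => ha (hB'.1.1 a h)
  · rintro ⟨w, hw, hend⟩
    obtain ⟨X, L, hL, rfl⟩ := exists_isGrowth_boundaryWalk_eq hw hend
    obtain ⟨B, hB, hX⟩ := exists_arcFilling hL.isPartialPerm hL.not_hasDescent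
    refine ⟨⟨B, hB⟩, Subtype.ext (funext fun m => ?_)⟩
    exact (isGrowth_of_isKNoncrossingBraid hB).unique hL hX (by omega)
end

section
/- (Reflection principle) For every integer s ≥ 0 and every point (i,j) with i > j ≥ 0, the number of P_{W2}-walks of length s ending at (i,j) equals the number of P_{Q2}-walks of length s ending at (i,j) minus the number of P_{Q2}-walks of length s ending at (j,i): ω^{i,j}_s = a^{i,j}_s − a^{j,i}_s. -/
/-- The steps allowed when a `𝒫_D`-walk moves from index `r` to index `r + 1`. -/
def pSteps (r : ℕ) : Finset (ℤ × ℤ) :=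
  if r % 2 = 0 then {(-1, 0), (0, -1), (0, 0)} else {(1, 0), (0, 1), (0, 0)}

theorem isPWalk_iff (D : Set (ℤ × ℤ)) (s : ℕ) (w : ℕ → ℤ × ℤ) :
    IsPWalk D s w ↔ w 0 = (1, 0) ∧ (∀ r ≤ s, w r ∈ D) ∧
      (∀ r < s, w (r + 1) - w r ∈ pSteps r) ∧ (∀ r, s ≤ r → w r = w s) := by
  unfold IsPWalk
  constructor
  · rintro ⟨h0, hD, hd, hu, hc⟩
    refine ⟨h0, hD, fun r hr => ?_, hc⟩
    unfold pSteps
    split_ifs with h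
    · simpa [DownStep] using hd (r + 1) (by omega) (by omega) (by omega)
    · simpa [UpStep] using hu (r + 1) (by omega) (by omega) (by omega)
  · rintro ⟨h0, hD, hs, hc⟩
    refine ⟨h0, hD, fun r h1 hr hp => ?_, fun r h1 hr hp => ?_, hc⟩
    · obtain ⟨r, rfl⟩ : ∃ k, r = k + 1 := ⟨r - 1, by omega⟩
      have := hs r (by omega)
      rw [pSteps, if_pos (by omega)] at this
      simpa [DownStep] using this
    · obtain ⟨r, rfl⟩ : ∃ k, r = k + 1 := ⟨r - 1, by omega⟩
      have := hs r (by omega)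
      rw [pSteps, if_neg (by omega)] at this
      simpa [UpStep] using this

/-- The `𝒫_D`-walks of length `s` ending at `p`. -/
abbrev PWalkTo (D : Set (ℤ × ℤ)) (s : ℕ) (p : ℤ × ℤ) : Type :=
  {w : ℕ → ℤ × ℤ // IsPWalk D s w ∧ w s = p}

theorem isEmpty_pWalkTo {D : Set (ℤ × ℤ)} {s : ℕ} {p : ℤ × ℤ} (hp : p ∉ D) :
    IsEmpty (PWalkTo D s p) :=
  ⟨fun w => hp (w.2.2 ▸ w.2.1.2.1 s le_rfl)⟩

/-- Removing the last step of a walk ending in `D`. -/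
def pWalkToSuccEquiv {D : Set (ℤ × ℤ)} (s : ℕ) {p : ℤ × ℤ} (hp : p ∈ D) :
    PWalkTo D (s + 1) p ≃ Σ d : pSteps s, PWalkTo D s (p - d) where
  toFun w := ⟨⟨p - w.1 s, by
      have h := ((isPWalk_iff _ _ _).1 w.2.1).2.2.1 s (by omega)
      rwa [w.2.2] at h⟩, fun r => w.1 (min r s), by
    obtain ⟨h0, hD, hs, -⟩ := (isPWalk_iff _ _ _).1 w.2.1
    refine ⟨(isPWalk_iff _ _ _).2 ⟨by simpa using h0, fun r _ => hD _ (by omega),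
      fun r hr => ?_, fun r hr => by simp [hr]⟩, by simp⟩
    simpa only [min_eq_left (Nat.succ_le_of_lt hr), min_eq_left hr.le] using hs r (by omega)⟩
  invFun x := ⟨fun r => if r ≤ s then x.2.1 r else p, by
    obtain ⟨⟨d, hd⟩, w, hw, hws⟩ := x
    obtain ⟨h0, hD, hs, -⟩ := (isPWalk_iff _ _ _).1 hw
    refine ⟨(isPWalk_iff _ _ _).2 ⟨by simpa using h0, fun r _ => ?_,
      fun r hr => ?_, fun r hr => ?_⟩, by simp⟩
    · dsimp only
      split_ifs with h
      exacts [hD r h, hp]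
    · rcases Nat.lt_succ_iff_lt_or_eq.1 hr with h | rfl
      · simpa [h.le, Nat.succ_le_iff.2 h] using hs r h
      · simpa [hws] using hd
    · simp [show ¬ r ≤ s by omega]⟩
  left_inv w := by
    obtain ⟨w, hw, hws⟩ := w
    apply Subtype.ext
    funext r
    dsimp only
    split_ifs with h
    · simp [h]
    · rw [← hws]
      exact (((isPWalk_iff _ _ _).1 hw).2.2.2 r (by omega)).symm
  right_inv x := by
    obtain ⟨⟨d, hd⟩, w, hw, hws⟩ := x
    have hdw : d = p - w s := by rw [hws]; abel
    subst hdw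
    have hfun : (fun r => if min r s ≤ s then w (min r s) else p) = w := by
      funext r
      rw [if_pos (min_le_right r s)]
      rcases le_total r s with h | h
      · rw [min_eq_left h]
      · rw [min_eq_right h, ((isPWalk_iff _ _ _).1 hw).2.2.2 r h]
    simp only [Sigma.mk.injEq, Subtype.mk.injEq]
    refine ⟨by simp, ?_⟩
    congr! 1
    all_goals simp

theorem eq_const_of_isPWalk_zero {D : Set (ℤ × ℤ)} {w : ℕ → ℤ × ℤ} (hw : IsPWalk D 0 w) :
    w = fun _ => (1, 0) := by
  funext r
  rw [hw.2.2.2.2 r (Nat.zero_le r), hw.1]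

theorem finite_pWalkTo (D : Set (ℤ × ℤ)) (s : ℕ) (p : ℤ × ℤ) : Finite (PWalkTo D s p) := by
  induction s generalizing p with
  | zero =>
    have : Subsingleton (PWalkTo D 0 p) := ⟨fun v w => Subtype.ext <| by
      rw [eq_const_of_isPWalk_zero v.2.1, eq_const_of_isPWalk_zero w.2.1]⟩
    infer_instance
  | succ s ih =>
    by_cases hp : p ∈ D
    · exact Finite.of_equiv _ (pWalkToSuccEquiv s hp).symm
    · have := isEmpty_pWalkTo (s := s + 1) hp
      infer_instance

theorem card_pWalkTo_of_notMem {D : Set (ℤ × ℤ)} {s : ℕ} {p : ℤ × ℤ} (hp : p ∉ D) :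
    Nat.card (PWalkTo D s p) = 0 := by
  have := isEmpty_pWalkTo (s := s) hp
  exact Nat.card_of_isEmpty

theorem card_pWalkTo_zero {D : Set (ℤ × ℤ)} (hD : ((1, 0) : ℤ × ℤ) ∈ D) (p : ℤ × ℤ) :
    Nat.card (PWalkTo D 0 p) = if p = (1, 0) then 1 else 0 := by
  split_ifs with h
  · subst h
    have : Unique (PWalkTo D 0 (1, 0)) :=
      { default := ⟨fun _ => (1, 0), (isPWalk_iff _ _ _).2
          ⟨rfl, fun _ _ => hD, fun _ h => absurd h (Nat.not_lt_zero _), fun _ _ => rfl⟩, rfl⟩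
        uniq := fun w => Subtype.ext (eq_const_of_isPWalk_zero w.2.1) }
    exact Nat.card_unique
  · have : IsEmpty (PWalkTo D 0 p) := ⟨fun w => h (w.2.2 ▸ w.2.1.1)⟩
    exact Nat.card_of_isEmpty

theorem card_pWalkTo_succ {D : Set (ℤ × ℤ)} (s : ℕ) {p : ℤ × ℤ} (hp : p ∈ D) :
    Nat.card (PWalkTo D (s + 1) p) = ∑ d ∈ pSteps s, Nat.card (PWalkTo D s (p - d)) := by
  have := finite_pWalkTo D s
  rw [Nat.card_congr (pWalkToSuccEquiv s hp), Nat.card_sigma]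
  exact Finset.sum_coe_sort (pSteps s) fun d => Nat.card (PWalkTo D s (p - d))

theorem swap_mem_pSteps {s : ℕ} {d : ℤ × ℤ} (hd : d ∈ pSteps s) : d.swap ∈ pSteps s := by
  unfold pSteps at *
  split_ifs at * <;> simp only [Finset.mem_insert, Finset.mem_singleton] at * <;>
    rcases hd with rfl | rfl | rfl <;> simp

theorem fst_le_snd_add_one_of_mem_pSteps {s : ℕ} {d : ℤ × ℤ} (hd : d ∈ pSteps s) :
    d.1 ≤ d.2 + 1 := by
  unfold pSteps at hd
  split_ifs at hd <;> simp only [Finset.mem_insert, Finset.mem_singleton] at hd <;>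
    rcases hd with rfl | rfl | rfl <;> simp

theorem sum_pSteps_swap (s : ℕ) (f : ℤ × ℤ → ℤ) :
    ∑ d ∈ pSteps s, f d.swap = ∑ d ∈ pSteps s, f d :=
  Finset.sum_nbij' Prod.swap Prod.swap (fun _ => swap_mem_pSteps) (fun _ => swap_mem_pSteps)
    (fun _ _ => Prod.swap_swap _) (fun _ _ => Prod.swap_swap _) (fun _ _ => rfl)

/-- The reflection principle on the closed half plane, where both sides vanish outside `W2`. -/
theorem omegaW_eq_aQ_sub_aQ_swap (s : ℕ) (p : ℤ × ℤ) (hp : p.2 ≤ p.1) :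
    (omegaW s p : ℤ) = (aQ s p : ℤ) - (aQ s p.swap : ℤ) := by
  induction s generalizing p with
  | zero =>
    have h1 : p.swap ≠ (1, 0) := by
      rintro h
      have h1 := congrArg Prod.fst h
      have h2 := congrArg Prod.snd h
      simp only [Prod.fst_swap, Prod.snd_swap] at h1 h2
      omega
    rw [omegaW, aQ, aQ, card_pWalkTo_zero (by simp [W2]), card_pWalkTo_zero (by simp [Q2]),
      card_pWalkTo_zero (by simp [Q2]), if_neg h1]
    simp
  | succ s ih =>
    by_cases hW : p ∈ W2
    · have hlt : p.2 < p.1 := hW.1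
      have h0 : 0 ≤ p.2 := hW.2
      have hQ : p ∈ Q2 := ⟨by omega, h0⟩
      have hQ' : p.swap ∈ Q2 := ⟨h0, by simp only [Prod.snd_swap]; omega⟩
      rw [omegaW, aQ, aQ, card_pWalkTo_succ s hW, card_pWalkTo_succ s hQ,
        card_pWalkTo_succ s hQ']
      push_cast
      rw [← sum_pSteps_swap s fun d => (Nat.card (PWalkTo Q2 s (p.swap - d)) : ℤ),
        ← Finset.sum_sub_distrib]
      refine Finset.sum_congr rfl fun d hd => ih (p - d) ?_
      have := fst_le_snd_add_one_of_mem_pSteps hd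
      simp only [Prod.fst_sub, Prod.snd_sub]
      omega
    · rw [omegaW, card_pWalkTo_of_notMem hW]
      rcases hp.eq_or_lt with h | h
      · rw [show p.swap = p from Prod.ext h h.symm]
        simp
      · have h0 : ¬ 0 ≤ p.2 := fun h0 => hW ⟨h, h0⟩
        rw [aQ, aQ, card_pWalkTo_of_notMem fun hQ => h0 hQ.2,
          card_pWalkTo_of_notMem fun hQ => h0 hQ.1]
        simp

/-- Reflection principle: for `s ≥ 0` and `i > j ≥ 0`,
`ω^{i,j}_s = a^{i,j}_s - a^{j,i}_s`. -/
theorem reflection_principle (s : ℕ) (i j : ℤ) (hij : j < i) (hj : 0 ≤ j) :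
    (omegaW s (i, j) : ℤ) = (aQ s (i, j) : ℤ) - (aQ s (j, i) : ℤ) := by
  exact omegaW_eq_aQ_sub_aQ_swap s (i, j) hij.le
end

section
/- For every integer ℓ ≥ 0 and every point (i,j) with i > j ≥ 0, ω^{i,j}_{2ℓ+2} = (a^{i,j}_{2ℓ+1} + a^{i−1,j}_{2ℓ+1} + a^{i,j−1}_{2ℓ+1}) − (a^{j,i}_{2ℓ+1} + a^{j−1,i}_{2ℓ+1} + a^{j,i−1}_{2ℓ+1}), where a^{i',j'}_s = 0 whenever i' < 0 or j' < 0. -/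
/-- The `𝒫_D`-walks of length `s` ending at `p`. -/
def pWalksTo (D : Set (ℤ × ℤ)) (s : ℕ) (p : ℤ × ℤ) : Set (ℕ → ℤ × ℤ) :=
  {w | IsPWalk D s w ∧ w s = p}

/-- The sign of the coordinate change in the step from index `s` to index `s + 1`. -/
def stepSign (s : ℕ) : ℤ := if s % 2 = 0 then -1 else 1

/-- Follow `w` up to index `s`, then stay at `p`. -/
def extendTo (s : ℕ) (p : ℤ × ℤ) (w : ℕ → ℤ × ℤ) : ℕ → ℤ × ℤ :=
  fun r => if r ≤ s then w r else p

lemma isPWalk_succ_iff (D : Set (ℤ × ℤ)) (s : ℕ) (w : ℕ → ℤ × ℤ) :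
    IsPWalk D (s + 1) w ↔ IsPWalk D s (extendTo s (w s) w) ∧ w (s + 1) ∈ D ∧
      (w (s + 1) - w s = (stepSign s, 0) ∨ w (s + 1) - w s = (0, stepSign s) ∨
        w (s + 1) - w s = (0, 0)) ∧ ∀ r, s + 1 ≤ r → w r = w (s + 1) := by
  have key : ∀ r ≤ s, extendTo s (w s) w r = w r := fun r hr => by simp [extendTo, hr]
  constructor
  · rintro ⟨h0, hD, ho, he, hc⟩
    refine ⟨⟨?_, ?_, ?_, ?_, ?_⟩, hD _ le_rfl, ?_, hc⟩
    · rw [key 0 (Nat.zero_le s), h0]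
    · intro r hr
      rw [key r hr]
      exact hD r (by omega)
    · intro r h1 hr hp
      rw [key r hr, key (r - 1) (by omega)]
      exact ho r h1 (by omega) hp
    · intro r h1 hr hp
      rw [key r hr, key (r - 1) (by omega)]
      exact he r h1 (by omega) hp
    · intro r hr
      rw [key s le_rfl]
      rcases hr.eq_or_lt with rfl | hr
      · rw [key _ le_rfl]
      · simp [extendTo, hr]
    · by_cases hs : s % 2 = 0
      · simpa [stepSign, hs, DownStep] using ho (s + 1) (by omega) le_rfl (by omega)
      · simpa [stepSign, hs, UpStep] using he (s + 1) (by omega) le_rfl (by omega)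
  · rintro ⟨⟨h0, hD, ho, he, -⟩, hp, hstep, hc⟩
    refine ⟨?_, ?_, ?_, ?_, hc⟩
    · rw [← key 0 (Nat.zero_le s), h0]
    · intro r hr
      rcases hr.eq_or_lt with rfl | hr
      · exact hp
      · rw [← key r (by omega)]
        exact hD r (by omega)
    · intro r h1 hr hpar
      rcases hr.eq_or_lt with rfl | hr
      · simpa [stepSign, show s % 2 = 0 by omega, DownStep] using hstep
      · rw [← key r (by omega), ← key (r - 1) (by omega)]
        exact ho r h1 (by omega) hpar
    · intro r h1 hr hpar
      rcases hr.eq_or_lt with rfl | hr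
      · simpa [stepSign, show s % 2 = 1 by omega, UpStep] using hstep
      · rw [← key r (by omega), ← key (r - 1) (by omega)]
        exact he r h1 (by omega) hpar

lemma extendTo_of_mem_pWalksTo {D : Set (ℤ × ℤ)} {s : ℕ} {p : ℤ × ℤ} {w : ℕ → ℤ × ℤ}
    (hw : w ∈ pWalksTo D s p) : extendTo s (w s) w = w := by
  funext r
  by_cases hr : r ≤ s
  · simp [extendTo, hr]
  · simp [extendTo, hr, hw.1.2.2.2.2 r (by omega)]

lemma pWalksTo_succ {D : Set (ℤ × ℤ)} (s : ℕ) {p : ℤ × ℤ} (hp : p ∈ D) :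
    pWalksTo D (s + 1) p = extendTo s p '' (pWalksTo D s p ∪
      (pWalksTo D s (p - (stepSign s, 0)) ∪ pWalksTo D s (p - (0, stepSign s)))) := by
  ext w
  constructor
  · rintro ⟨hw, hwp⟩
    obtain ⟨hw', -, hstep, hc⟩ := (isPWalk_succ_iff D s w).1 hw
    refine ⟨extendTo s (w s) w, ?_, ?_⟩
    · have hend : extendTo s (w s) w s = w s := by simp [extendTo]
      rw [hwp] at hstep
      rcases hstep with h | h | h
      · exact Or.inr (Or.inl ⟨hw', by rw [hend, ← h]; abel⟩)
      · exact Or.inr (Or.inr ⟨hw', by rw [hend, ← h]; abel⟩)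
      · exact Or.inl ⟨hw', by rw [hend]; exact (sub_eq_zero.1 h).symm⟩
    · funext r
      by_cases hr : r ≤ s
      · simp [extendTo, hr]
      · simp [extendTo, hr, hc r (by omega), hwp]
  · rintro ⟨v, hv, rfl⟩
    have hv' : IsPWalk D s v ∧ (p - v s = (stepSign s, 0) ∨ p - v s = (0, stepSign s) ∨
        p - v s = (0, 0)) := by
      rcases hv with hv | hv | hv <;> refine ⟨hv.1, ?_⟩ <;> simp [hv.2, ← Prod.zero_eq_mk]
    have hfix : extendTo s (v s) v = v :=
      extendTo_of_mem_pWalksTo (D := D) (p := v s) ⟨hv'.1, rfl⟩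
    have hrestrict : extendTo s (v s) (extendTo s p v) = v := by
      rw [← hfix]
      funext r
      by_cases hr : r ≤ s <;> simp [extendTo, hr]
    refine ⟨(isPWalk_succ_iff D s _).2 ?_, by simp [extendTo]⟩
    have hs : extendTo s p v s = v s := by simp [extendTo]
    have hs1 : ∀ r, s + 1 ≤ r → extendTo s p v r = p := fun r hr => by
      simp [extendTo, show ¬ r ≤ s by omega]
    rw [hs, hrestrict, hs1 _ le_rfl]
    exact ⟨hv'.1, hp, hv'.2, hs1⟩

lemma pWalksTo_eq_empty {D : Set (ℤ × ℤ)} (s : ℕ) {p : ℤ × ℤ} (hp : p ∉ D) :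
    pWalksTo D s p = ∅ := by
  ext w
  simp only [Set.mem_empty_iff_false, iff_false]
  rintro ⟨hw, rfl⟩
  exact hp (hw.2.1 s le_rfl)

lemma pWalksTo_zero {D : Set (ℤ × ℤ)} (hD : (1, 0) ∈ D) (p : ℤ × ℤ) :
    pWalksTo D 0 p = if p = (1, 0) then {fun _ => (1, 0)} else ∅ := by
  ext w
  split_ifs with h
  · subst h
    constructor
    · rintro ⟨hw, hp⟩
      funext r
      rw [hw.2.2.2.2 r (Nat.zero_le r), hp]
    · rintro rfl
      refine ⟨⟨rfl, fun _ _ => hD, ?_, ?_, fun _ _ => rfl⟩, rfl⟩ <;> intros <;> omega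
  · simp only [Set.mem_empty_iff_false, iff_false]
    rintro ⟨hw, rfl⟩
    exact h hw.1

lemma pWalksTo_finite {D : Set (ℤ × ℤ)} (hD : (1, 0) ∈ D) (s : ℕ) (p : ℤ × ℤ) :
    (pWalksTo D s p).Finite := by
  induction s generalizing p with
  | zero =>
    rw [pWalksTo_zero hD]
    split_ifs
    · exact Set.finite_singleton _
    · exact Set.finite_empty
  | succ s ih =>
    by_cases hp : p ∈ D
    · rw [pWalksTo_succ s hp]
      exact ((ih _).union ((ih _).union (ih _))).image _
    · rw [pWalksTo_eq_empty _ hp]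
      exact Set.finite_empty

lemma disjoint_pWalksTo (D : Set (ℤ × ℤ)) (s : ℕ) {p q : ℤ × ℤ} (h : p ≠ q) :
    Disjoint (pWalksTo D s p) (pWalksTo D s q) :=
  Set.disjoint_left.2 fun _ hp hq => h (hp.2.symm.trans hq.2)

lemma injOn_extendTo (D : Set (ℤ × ℤ)) (s : ℕ) (p : ℤ × ℤ) :
    Set.InjOn (extendTo s p) {w | IsPWalk D s w} := by
  intro v hv w hw h
  have hle : ∀ r ≤ s, v r = w r := fun r hr => by
    simpa [extendTo, hr] using congrFun h r
  funext r
  rcases le_total r s with hr | hr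
  · exact hle r hr
  · rw [hv.2.2.2.2 r hr, hw.2.2.2.2 r hr, hle s le_rfl]

lemma ncard_pWalksTo_succ {D : Set (ℤ × ℤ)} (hD : (1, 0) ∈ D) (s : ℕ) {p : ℤ × ℤ}
    (hp : p ∈ D) :
    (pWalksTo D (s + 1) p).ncard = (pWalksTo D s p).ncard +
      ((pWalksTo D s (p - (stepSign s, 0))).ncard +
        (pWalksTo D s (p - (0, stepSign s))).ncard) := by
  have hsign : stepSign s ≠ 0 := by
    unfold stepSign
    split_ifs <;> decide
  have hfin := pWalksTo_finite hD s
  rw [pWalksTo_succ s hp, Set.InjOn.ncard_image, Set.ncard_union_eq _ (hfin _)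
    ((hfin _).union (hfin _)), Set.ncard_union_eq _ (hfin _) (hfin _)]
  · refine disjoint_pWalksTo D s fun h => hsign ?_
    simpa using congrArg Prod.fst h
  · refine Set.disjoint_union_right.2 ⟨disjoint_pWalksTo D s fun h => hsign ?_,
      disjoint_pWalksTo D s fun h => hsign ?_⟩
    · have h1 : p.1 = p.1 - stepSign s := congrArg Prod.fst h
      omega
    · have h1 : p.2 = p.2 - stepSign s := congrArg Prod.snd h
      omega
  · refine (injOn_extendTo D s p).mono ?_
    rintro w (hw | hw | hw) <;> exact hw.1

/-- Reflection principle: steps change `a - b` by at most one and the steps and the quarter plane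
are invariant under swapping coordinates. -/
lemma ncard_pWalksTo_W2 (s : ℕ) (i j : ℤ) (hij : j ≤ i) :
    ((pWalksTo W2 s (i, j)).ncard : ℤ) =
      (pWalksTo Q2 s (i, j)).ncard - (pWalksTo Q2 s (j, i)).ncard := by
  have hQ : ((1, 0) : ℤ × ℤ) ∈ Q2 := by simp [Q2]
  have hW : ((1, 0) : ℤ × ℤ) ∈ W2 := by simp [W2]
  induction s generalizing i j with
  | zero =>
    rw [pWalksTo_zero hQ, pWalksTo_zero hQ, pWalksTo_zero hW]
    have h : ((j, i) : ℤ × ℤ) ≠ (1, 0) := by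
      simp only [ne_eq, Prod.mk.injEq]
      omega
    simp [h]
  | succ s ih =>
    rcases hij.eq_or_lt with rfl | hij
    · rw [pWalksTo_eq_empty (D := W2) (p := (j, j)) _ (by simp [W2])]
      simp
    by_cases hj : 0 ≤ j
    · rw [ncard_pWalksTo_succ hW s (show (i, j) ∈ W2 from ⟨hij, hj⟩),
        ncard_pWalksTo_succ hQ s (show (i, j) ∈ Q2 from ⟨hj.trans hij.le, hj⟩),
        ncard_pWalksTo_succ hQ s (show (j, i) ∈ Q2 from ⟨hj, hj.trans hij.le⟩)]
      have hsign : stepSign s = -1 ∨ stepSign s = 1 := by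
        unfold stepSign
        split_ifs <;> simp
      have h1 := ih i j hij.le
      have h2 := ih (i - stepSign s) j (by omega)
      have h3 := ih i (j - stepSign s) (by omega)
      simp only [Prod.mk_sub_mk, sub_zero]
      push_cast
      linarith
    · rw [pWalksTo_eq_empty (D := W2) (p := (i, j)) _ (fun h => hj h.2),
        pWalksTo_eq_empty (D := Q2) (p := (i, j)) _ (fun h => hj h.2),
        pWalksTo_eq_empty (D := Q2) (p := (j, i)) _ (fun h => hj h.1)]
      simp

/-- For `ℓ ≥ 0` and `i > j ≥ 0`,
`ω^{i,j}_{2ℓ+2} = (a^{i,j}_{2ℓ+1} + a^{i-1,j}_{2ℓ+1} + a^{i,j-1}_{2ℓ+1})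
  - (a^{j,i}_{2ℓ+1} + a^{j-1,i}_{2ℓ+1} + a^{j,i-1}_{2ℓ+1})`
(counts at points with a negative coordinate vanish automatically). -/
theorem omegaW_even_formula (ℓ : ℕ) (i j : ℤ) (hij : j < i) (hj : 0 ≤ j) :
    (omegaW (2 * ℓ + 2) (i, j) : ℤ)
      = ((aQ (2 * ℓ + 1) (i, j) + aQ (2 * ℓ + 1) (i - 1, j) + aQ (2 * ℓ + 1) (i, j - 1) : ℕ) : ℤ)
        - ((aQ (2 * ℓ + 1) (j, i) + aQ (2 * ℓ + 1) (j - 1, i) + aQ (2 * ℓ + 1) (j, i - 1) : ℕ) : ℤ) := by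
  change ((pWalksTo W2 (2 * ℓ + 1 + 1) (i, j)).ncard : ℤ)
    = (((pWalksTo Q2 (2 * ℓ + 1) (i, j)).ncard + (pWalksTo Q2 (2 * ℓ + 1) (i - 1, j)).ncard
        + (pWalksTo Q2 (2 * ℓ + 1) (i, j - 1)).ncard : ℕ) : ℤ)
      - (((pWalksTo Q2 (2 * ℓ + 1) (j, i)).ncard + (pWalksTo Q2 (2 * ℓ + 1) (j - 1, i)).ncard
        + (pWalksTo Q2 (2 * ℓ + 1) (j, i - 1)).ncard : ℕ) : ℤ)
  have hQ : ((1, 0) : ℤ × ℤ) ∈ Q2 := by simp [Q2]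
  have hsign : stepSign (2 * ℓ + 1) = 1 := by simp [stepSign, Nat.add_mod]
  rw [ncard_pWalksTo_W2 _ _ _ hij.le,
    ncard_pWalksTo_succ hQ _ (show (i, j) ∈ Q2 from ⟨hj.trans hij.le, hj⟩),
    ncard_pWalksTo_succ hQ _ (show (j, i) ∈ Q2 from ⟨hj, hj.trans hij.le⟩)]
  simp only [hsign, Prod.mk_sub_mk, sub_zero]
  push_cast
  ring
end

section
/- For every integer ℓ ≥ 0 and every point (i,j) with i > j ≥ 0, the number of B_{W2}-walks of length 2ℓ ending at (i,j) equals the number of P_{W2}-walks of length 2ℓ+1 ending at (i,j): σ^{i,j}_{2ℓ} = ω^{i,j}_{2ℓ+1}. -/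
/-- The first step of a `𝒫_{W₂}`-walk is forced to be the zero step. -/
theorem IsPWalk.apply_one {s : ℕ} {w : ℕ → ℤ × ℤ} (h : IsPWalk W2 (s + 1) w) : w 1 = (1, 0) := by
  obtain ⟨h0, hD, hodd, -, -⟩ := h
  have hmem := hD 1 (by omega)
  have hstep := hodd 1 le_rfl (by omega) rfl
  simp only [W2, Set.mem_ofPred_eq] at hmem
  simp only [DownStep, Nat.sub_self, h0, Prod.ext_iff, Prod.fst_sub, Prod.snd_sub] at hstep ⊢
  omega

/-- Prepending a zero step to a `ℬ_{W₂}`-walk gives a `𝒫_{W₂}`-walk. -/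
theorem IsBWalk.isPWalk_pred {s : ℕ} {w : ℕ → ℤ × ℤ} (h : IsBWalk W2 s w) :
    IsPWalk W2 (s + 1) (fun r => w (r - 1)) := by
  obtain ⟨h0, hD, hodd, heven, hconst⟩ := h
  refine ⟨h0, fun r hr => hD _ (by omega), fun r h1 hr hmod => ?_,
    fun r h1 hr hmod => hodd (r - 1) (by omega) (by omega) (by omega),
    fun r hr => hconst _ (by omega)⟩
  rcases h1.eq_or_lt with rfl | h1
  · exact Or.inr (Or.inr (sub_self _))
  · exact heven (r - 1) (by omega) (by omega) (by omega)

/-- Removing the first step of a `𝒫_{W₂}`-walk gives a `ℬ_{W₂}`-walk. -/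
theorem IsPWalk.isBWalk_succ {s : ℕ} {w : ℕ → ℤ × ℤ} (h : IsPWalk W2 (s + 1) w) :
    IsBWalk W2 s (fun r => w (r + 1)) := by
  have h1 := h.apply_one
  obtain ⟨h0, hD, hodd, heven, hconst⟩ := h
  refine ⟨h1, fun r hr => hD _ (by omega), fun r hr1 hr hmod => ?_, fun r hr1 hr hmod => ?_,
    fun r hr => hconst _ (by omega)⟩
  · simpa [Nat.sub_add_cancel hr1] using heven (r + 1) (by omega) (by omega) (by omega)
  · simpa [Nat.sub_add_cancel hr1] using hodd (r + 1) (by omega) (by omega) (by omega)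

/-- `ℬ_{W₂}`-walks of length `s` correspond to `𝒫_{W₂}`-walks of length `s + 1` with the same
endpoint. -/
def bWalkEquivPWalk (s : ℕ) (p : ℤ × ℤ) :
    {w : ℕ → ℤ × ℤ // IsBWalk W2 s w ∧ w s = p} ≃
      {w : ℕ → ℤ × ℤ // IsPWalk W2 (s + 1) w ∧ w (s + 1) = p} where
  toFun w := ⟨fun r => w.1 (r - 1), w.2.1.isPWalk_pred, w.2.2⟩
  invFun w := ⟨fun r => w.1 (r + 1), w.2.1.isBWalk_succ, w.2.2⟩
  left_inv _ := rfl
  right_inv w := by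
    ext1
    funext r
    cases r with
    | zero => exact w.2.1.apply_one.trans w.2.1.1.symm
    | succ r => rfl

/-- For `ℓ ≥ 0` and `i > j ≥ 0`, the number of `ℬ_{W₂}`-walks of length `2ℓ`
ending at `(i,j)` equals the number of `𝒫_{W₂}`-walks of length `2ℓ+1`
ending at `(i,j)`: `σ^{i,j}_{2ℓ} = ω^{i,j}_{2ℓ+1}`. -/
theorem sigmaB_eq_omegaW (ℓ : ℕ) (i j : ℤ) (hij : j < i) (hj : 0 ≤ j) :
    sigmaB (2 * ℓ) (i, j) = omegaW (2 * ℓ + 1) (i, j) :=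
  Nat.card_congr (bWalkEquivPWalk (2 * ℓ) (i, j))
end
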